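/- Let k ≥ 1 and 0 < R₀ < R₁, and let 𝓕, 𝓒 ⊂ ℝ^{2k} be the floor and ceiling of the Lagrangian tetragon with parameters R₀, R₁ (and T = π/4). Let U : ℝ^k × ℝ → ℝ be smooth and 1-periodic in t, let β ≥ 0, and assume U(q,t) ≤ −β whenever √R₀ ≤ |q| ≤ √R₁ and U(0,t) = 0 for all t. If the Hamiltonian G(p,q,t) := |p|²/2 + U(q,t) is complete, then there exists a Hamiltonian chord of G from 𝓕 to 𝓒 of time-length at most π(R₁−R₀)/(2R₀ + 4β). -/

import Mathlib

open Real Set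

noncomputable section

/-- `ℝ^k` as a function type; the Euclidean norm is `eucNorm`. -/
abbrev Vec (k : ℕ) := Fin k → ℝ

/-- The phase space `ℝ^{2k} = ℝ^k(p) × ℝ^k(q)`. -/
abbrev Phase (k : ℕ) := Vec k × Vec k

/-- Euclidean norm on `ℝ^k`. -/
def eucNorm {k : ℕ} (x : Vec k) : ℝ := Real.sqrt (∑ i, x i ^ 2)

/-- The vector of partial derivatives of `f` at `x` (the gradient w.r.t. the Euclidean
structure). -/
def gradVec {k : ℕ} (f : Vec k → ℝ) (x : Vec k) : Vec k :=
  fun i => fderiv ℝ f x (Pi.single i 1)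

/-- `γ` solves Hamilton's equations `p' = -∂G/∂q`, `q' = ∂G/∂p` of the time-dependent
Hamiltonian `G` at every time `t ∈ S`. -/
def IsHamSolOn {k : ℕ} (G : Phase k × ℝ → ℝ) (γ : ℝ → Phase k) (S : Set ℝ) : Prop :=
  ∀ t ∈ S,
    HasDerivAt (fun s => (γ s).1) (-(gradVec (fun q => G (((γ t).1, q), t)) (γ t).2)) t ∧
    HasDerivAt (fun s => (γ s).2) (gradVec (fun p => G ((p, (γ t).2), t)) (γ t).1) t

/-- `G` is complete: through every initial condition there is a solution of Hamilton's
equations defined on all of `ℝ`. -/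
def HamComplete {k : ℕ} (G : Phase k × ℝ → ℝ) : Prop :=
  ∀ (t₀ : ℝ) (x₀ : Phase k), ∃ γ : ℝ → Phase k, γ t₀ = x₀ ∧ IsHamSolOn G γ Set.univ

/-- The floor (for `R = R₀`) resp. ceiling (for `R = R₁`) of the Lagrangian tetragon in
`ℂ^k = ℝ^{2k}` with `T = π/4`: the points `(√R·cos θ·u, √R·sin θ·u)`, `|u| = 1`,
`θ ∈ [0, π/2]`. -/
def sphereFloor (k : ℕ) (R : ℝ) : Set (Phase k) :=
  {x | ∃ (u : Vec k) (θ : ℝ), eucNorm u = 1 ∧ θ ∈ Icc 0 (π / 2) ∧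
        x = ((Real.sqrt R * Real.cos θ) • u, (Real.sqrt R * Real.sin θ) • u)}

/-- The high wall `{(p, 0) : √R₀ ≤ |p| ≤ √R₁}`. -/
def sphereHigh (k : ℕ) (R₀ R₁ : ℝ) : Set (Phase k) :=
  {x | x.2 = 0 ∧ Real.sqrt R₀ ≤ eucNorm x.1 ∧ eucNorm x.1 ≤ Real.sqrt R₁}

/-- The low wall `{(0, q) : √R₀ ≤ |q| ≤ √R₁}`. -/
def sphereLow (k : ℕ) (R₀ R₁ : ℝ) : Set (Phase k) :=
  {x | x.1 = 0 ∧ Real.sqrt R₀ ≤ eucNorm x.2 ∧ eucNorm x.2 ≤ Real.sqrt R₁}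

section

open scoped RealInnerProductSpace Topology NNReal

variable {E : Type*} [NormedAddCommGroup E] [InnerProductSpace ℝ E]

/-- The primitive `∫₀ʳ √(R - ρ²) dρ`; `q ↦ radialPrimitive R |q|` generates the floor. -/
def radialPrimitive (R r : ℝ) : ℝ := ∫ ρ in (0 : ℝ)..r, √(R - ρ ^ 2)

lemma hasDerivAt_radialPrimitive (R r : ℝ) :
    HasDerivAt (radialPrimitive R) (√(R - r ^ 2)) r := by
  have hc : Continuous fun ρ : ℝ => √(R - ρ ^ 2) := by fun_prop
  exact intervalIntegral.integral_hasDerivAt_right (hc.intervalIntegrable _ _)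
    (hc.stronglyMeasurableAtFilter _ _) hc.continuousAt

lemma continuous_radialPrimitive (R : ℝ) : Continuous (radialPrimitive R) :=
  continuous_iff_continuousAt.2 fun r => (hasDerivAt_radialPrimitive R r).continuousAt

@[simp] lemma radialPrimitive_zero (R : ℝ) : radialPrimitive R 0 = 0 := by
  simp [radialPrimitive]

lemma radialPrimitive_sub_le {R a b K : ℝ} (hab : a ≤ b)
    (hK : ∀ ρ, a ≤ ρ → ρ ≤ b → √(R - ρ ^ 2) ≤ K) :
    radialPrimitive R b - radialPrimitive R a ≤ K * (b - a) := by
  refine (convex_Icc a b).image_sub_le_mul_sub_of_deriv_le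
    (continuous_radialPrimitive R).continuousOn
    (fun x _ => (hasDerivAt_radialPrimitive R x).differentiableAt.differentiableWithinAt)
    (fun x hx => ?_) a (left_mem_Icc.2 hab) b (right_mem_Icc.2 hab) hab
  rw [interior_Icc] at hx
  rw [(hasDerivAt_radialPrimitive R x).deriv]
  exact hK x hx.1.le hx.2.le

lemma le_radialPrimitive_sub {R a b K : ℝ} (hab : a ≤ b)
    (hK : ∀ ρ, a ≤ ρ → ρ ≤ b → K ≤ √(R - ρ ^ 2)) :
    K * (b - a) ≤ radialPrimitive R b - radialPrimitive R a := by
  refine (convex_Icc a b).mul_sub_le_image_sub_of_le_deriv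
    (continuous_radialPrimitive R).continuousOn
    (fun x _ => (hasDerivAt_radialPrimitive R x).differentiableAt.differentiableWithinAt)
    (fun x hx => ?_) a (left_mem_Icc.2 hab) b (right_mem_Icc.2 hab) hab
  rw [interior_Icc] at hx
  rw [(hasDerivAt_radialPrimitive R x).deriv]
  exact hK x hx.1.le hx.2.le

lemma radialPrimitive_mono (R : ℝ) : Monotone (radialPrimitive R) := fun a b hab => by
  have := le_radialPrimitive_sub (R := R) (K := 0) hab fun ρ _ _ => sqrt_nonneg _
  linarith

lemma radialPrimitive_sqrt {R : ℝ} (hR : 0 < R) : radialPrimitive R (√R) = π * R / 4 := by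
  have hc : Continuous fun ρ : ℝ => √(1 - ρ ^ 2) := by fun_prop
  have h1 : ∫ ρ in (0 : ℝ)..1, √(1 - ρ ^ 2) = π / 4 := by
    have hs := intervalIntegral.integral_add_adjacent_intervals
      (hc.intervalIntegrable (-1) 0 (μ := MeasureTheory.volume)) (hc.intervalIntegrable 0 1)
    have hn : ∫ ρ in (-1 : ℝ)..0, √(1 - ρ ^ 2) = ∫ ρ in (0 : ℝ)..1, √(1 - ρ ^ 2) := by
      have := intervalIntegral.integral_comp_neg (a := (0 : ℝ)) (b := 1)
        fun ρ : ℝ => √(1 - ρ ^ 2)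
      simpa using this.symm
    rw [integral_sqrt_one_sub_sq, hn] at hs
    linarith
  have h2 := intervalIntegral.mul_integral_comp_mul_left (a := (0 : ℝ)) (b := 1)
    (f := fun ρ : ℝ => √(R - ρ ^ 2)) (c := √R)
  rw [mul_zero, mul_one] at h2
  rw [radialPrimitive, ← h2]
  have h3 : ∀ ρ : ℝ, √(R - (√R * ρ) ^ 2) = √R * √(1 - ρ ^ 2) := fun ρ => by
    rw [← sqrt_mul hR.le, mul_pow, sq_sqrt hR.le]
    ring_nf
  simp only [h3, intervalIntegral.integral_const_mul, h1]
  rw [← mul_assoc, mul_self_sqrt hR.le]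
  ring

lemma radialPrimitive_of_le {R r : ℝ} (hR : 0 < R) (hr : √R ≤ r) :
    radialPrimitive R r = π * R / 4 := by
  refine le_antisymm ?_ (radialPrimitive_sqrt hR ▸ radialPrimitive_mono R hr)
  have := radialPrimitive_sub_le (R := R) (K := 0) hr fun ρ h _ =>
    (sqrt_eq_zero_of_nonpos (by nlinarith [sq_sqrt hR.le, sqrt_nonneg R])).le
  rw [radialPrimitive_sqrt hR] at this
  linarith

lemma radialPrimitive_le {R r : ℝ} (hR : 0 < R) : radialPrimitive R r ≤ π * R / 4 :=
  (radialPrimitive_mono R (le_max_left r (√R))).trans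
    (radialPrimitive_of_le hR (le_max_right _ _)).le

lemma mul_le_radialPrimitive {R r : ℝ} (hr : 0 ≤ r) :
    √(R - r ^ 2) * r ≤ radialPrimitive R r := by
  have := le_radialPrimitive_sub (R := R) (K := √(R - r ^ 2)) hr fun ρ h0 h1 =>
    sqrt_le_sqrt (by nlinarith)
  simpa using this

lemma radialPrimitive_sub_radialPrimitive_le {R₀ R₁ r : ℝ} (h0 : 0 < R₀) (h1 : R₀ < R₁)
    (hr : r ≤ √R₁) :
    radialPrimitive R₁ r - radialPrimitive R₀ r ≤ π * (R₁ - R₀) / 4 := by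
  have hd : ∀ x, HasDerivAt (fun r => radialPrimitive R₁ r - radialPrimitive R₀ r)
      (√(R₁ - x ^ 2) - √(R₀ - x ^ 2)) x := fun x =>
    (hasDerivAt_radialPrimitive R₁ x).sub (hasDerivAt_radialPrimitive R₀ x)
  have hm : Monotone fun r => radialPrimitive R₁ r - radialPrimitive R₀ r :=
    monotone_of_deriv_nonneg (fun x => (hd x).differentiableAt) fun x => by
      rw [(hd x).deriv]
      exact sub_nonneg.2 (sqrt_le_sqrt (by linarith))
  have := hm hr
  simp only [radialPrimitive_of_le (h0.trans h1) le_rfl,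
    radialPrimitive_of_le h0 (sqrt_le_sqrt h1.le)] at this
  linarith

/-- Bound on the variation of the primitive over one backward step of the radial flow. -/
lemma radialPrimitive_sub_back_le {R r h : ℝ} (hr0 : 0 ≤ r) (hr : r ≤ √R) (hR : 0 < R)
    (hh : 0 < h) :
    radialPrimitive R r - radialPrimitive R |r - h * √(R - r ^ 2)|
      ≤ h * (R - r ^ 2 + R * √(3 * h)) := by
  have hrR : r ^ 2 ≤ R := by nlinarith [sq_sqrt hR.le, sqrt_nonneg R]
  set p := √(R - r ^ 2) with hp
  have hp0 : 0 ≤ p := sqrt_nonneg _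
  have hpp : p ^ 2 = R - r ^ 2 := sq_sqrt (by linarith)
  have hpR : p ≤ √R := sqrt_le_sqrt (by nlinarith)
  have hhp : 0 ≤ h * p := by positivity
  have h1 := radialPrimitive_sub_le (R := R) (a := r - h * p) (b := r)
    (K := p + √(3 * h * R)) (by linarith) fun ρ h0 h1 => by
      rw [sqrt_le_left (by positivity)]
      have : (p + √(3 * h * R)) ^ 2 = p ^ 2 + 2 * p * √(3 * h * R) + 3 * h * R := by
        rw [add_sq, sq_sqrt (show 0 ≤ 3 * h * R by positivity)]
      rw [this, hpp]
      have h2 : r ^ 2 - ρ ^ 2 ≤ 3 * h * R := by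
        by_cases h3 : 0 ≤ r + ρ
        · have : (r - ρ) * (r + ρ) ≤ (h * p) * (2 * r) :=
            mul_le_mul (by linarith) (by linarith) h3 hhp
          have h4 : p * r ≤ R := by nlinarith [sq_nonneg (p - r)]
          nlinarith [mul_le_mul_of_nonneg_left h4 hh.le, mul_pos hh hR]
        · nlinarith [mul_pos hh hR]
      have h5 : 0 ≤ p * √(3 * h * R) := by positivity
      linarith
  have h2 := radialPrimitive_mono R (le_abs_self (r - h * p))
  have h3 : p * √(3 * h * R) ≤ R * √(3 * h) := by
    rw [sqrt_mul (by positivity)]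
    calc p * (√(3 * h) * √R) ≤ √R * (√(3 * h) * √R) := by gcongr
      _ = R * √(3 * h) := by
        rw [mul_comm, mul_assoc, mul_self_sqrt hR.le, mul_comm]
  have h4 : (p + √(3 * h * R)) * (r - (r - h * p)) = h * (p ^ 2 + p * √(3 * h * R)) := by ring
  rw [h4, hpp] at h1
  nlinarith [mul_le_mul_of_nonneg_left h3 hh.le]

/-- Bound on the variation of the primitive over one forward step of the radial flow. -/
lemma le_radialPrimitive_sub_forward {R r h : ℝ} (hr0 : 0 ≤ r) (hr : r ≤ √R) (hR : 0 < R)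
    (hh : 0 < h) (hh1 : h ≤ 1) :
    h * (R - r ^ 2 - R * √(3 * h))
      ≤ radialPrimitive R (r + h * √(R - r ^ 2)) - radialPrimitive R r := by
  have hrR : r ^ 2 ≤ R := by nlinarith [sq_sqrt hR.le, sqrt_nonneg R]
  set p := √(R - r ^ 2) with hp
  have hp0 : 0 ≤ p := sqrt_nonneg _
  have hpp : p ^ 2 = R - r ^ 2 := sq_sqrt (by linarith)
  have hpR : p ≤ √R := sqrt_le_sqrt (by nlinarith)
  have hhp : 0 ≤ h * p := by positivity
  have h1 := le_radialPrimitive_sub (R := R) (a := r) (b := r + h * p)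
    (K := p - √(3 * h * R)) (by linarith) fun ρ h0 h1 => by
      rw [sub_le_iff_le_add]
      refine abs_le_of_sq_le_sq' ?_ (by positivity) |>.2
      have h2 : ρ ^ 2 - r ^ 2 ≤ 3 * h * R := by
        have h3 : ρ ^ 2 ≤ (r + h * p) ^ 2 := pow_le_pow_left₀ (hr0.trans h0) h1 2
        have h4 : 2 * (p * r) ≤ 2 * R := by nlinarith [sq_nonneg (p - r)]
        have h5 : h * p ^ 2 ≤ R := by nlinarith [sq_nonneg p, sq_nonneg r]
        nlinarith [mul_le_mul_of_nonneg_left h4 hh.le, mul_le_mul_of_nonneg_left h5 hh.le]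
      have h3 : R - ρ ^ 2 ≤ √(R - ρ ^ 2) ^ 2 := by
        rcases le_total 0 (R - ρ ^ 2) with h | h
        · rw [sq_sqrt h]
        · exact h.trans (sq_nonneg _)
      have h4 : √(3 * h * R) ^ 2 = 3 * h * R := sq_sqrt (by positivity)
      have h5 : 0 ≤ √(R - ρ ^ 2) * √(3 * h * R) := by positivity
      nlinarith
  have h3 : p * √(3 * h * R) ≤ R * √(3 * h) := by
    rw [sqrt_mul (by positivity)]
    calc p * (√(3 * h) * √R) ≤ √R * (√(3 * h) * √R) := by gcongr
      _ = R * √(3 * h) := by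
        rw [mul_comm, mul_assoc, mul_self_sqrt hR.le, mul_comm]
  have h4 : (p - √(3 * h * R)) * (r + h * p - r) = h * (p ^ 2 - p * √(3 * h * R)) := by ring
  rw [h4, hpp] at h1
  nlinarith [mul_le_mul_of_nonneg_left h3 hh.le]

/-- A function with nonnegative increments to the right has nonnegative right derivative. -/
lemma HasDerivWithinAt.nonneg_of_right_min {φ : ℝ → ℝ} {d ε₀ : ℝ}
    (hd : HasDerivWithinAt φ d (Ioi 0) 0) (hε₀ : 0 < ε₀)
    (hmin : ∀ ε, 0 < ε → ε < ε₀ → φ 0 ≤ φ ε) : 0 ≤ d := by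
  have h1 := (hasDerivWithinAt_iff_tendsto_slope' (by simp)).1 hd
  refine ge_of_tendsto h1 ?_
  filter_upwards [Ioo_mem_nhdsGT hε₀] with ε hε
  rw [slope_def_field, sub_zero]
  exact div_nonneg (sub_nonneg.2 (hmin ε hε.1 hε.2)) hε.1.le

lemma exists_lex_min {X : Type*} [TopologicalSpace X] (φ : ℕ → ℝ → X → ℝ) {S : Set X}
    (hS : IsCompact S) (hne : S.Nonempty) (hc : ∀ n, Continuous fun z : ℝ × X => φ n z.1 z.2)
    (hp : ∀ n t x, φ n (t + 1) x = φ n t x) {a N : ℕ} (haN : a ≤ N) :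
    ∃ n t, ∃ x ∈ S, a ≤ n ∧ n ≤ N ∧ t ∈ Icc (0 : ℝ) 1 ∧
      (∀ n' t', ∀ x' ∈ S, a ≤ n' → n' ≤ N → φ n t x ≤ φ n' t' x') ∧
      (∀ n' t', ∀ x' ∈ S, a ≤ n' → n' < n → φ n t x < φ n' t' x') := by
  have h1 : ∀ n, ∃ t ∈ Icc (0 : ℝ) 1, ∃ x ∈ S, ∀ t', ∀ x' ∈ S, φ n t x ≤ φ n t' x' := fun n => by
    obtain ⟨⟨t, x⟩, ⟨ht, hx⟩, hm⟩ := (isCompact_Icc.prod hS).exists_isMinOn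
      ((nonempty_Icc.2 (zero_le_one' ℝ)).prod hne) (hc n).continuousOn
    refine ⟨t, ht, x, hx, fun t' x' hx' => ?_⟩
    have hper : Function.Periodic (fun s => φ n s x') 1 := fun s => hp n s x'
    obtain ⟨s, hs, hs'⟩ := hper.exists_mem_Ico₀ one_pos t'
    rw [hs']
    exact hm (Set.mk_mem_prod (Ico_subset_Icc_self hs) hx')
  choose t ht x hx hm using h1
  obtain ⟨n, hn, hmin⟩ := Finset.exists_min_image (Finset.Icc a N)
    (fun n => toLex (φ n (t n) (x n), n)) (Finset.nonempty_Icc.2 haN)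
  rw [Finset.mem_Icc] at hn
  have key : ∀ n', a ≤ n' → n' ≤ N → φ n (t n) (x n) < φ n' (t n') (x n') ∨
      φ n (t n) (x n) = φ n' (t n') (x n') ∧ n ≤ n' := fun n' h1 h2 => by
    simpa [Prod.Lex.toLex_le_toLex] using hmin n' (Finset.mem_Icc.2 ⟨h1, h2⟩)
  refine ⟨n, t n, x n, hx n, hn.1, hn.2, ht n, fun n' t' x' hx' h1 h2 => ?_,
    fun n' t' x' hx' h1 h2 => ?_⟩
  · refine le_trans ?_ (hm n' t' x' hx')
    rcases key n' h1 h2 with h | h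
    exacts [h.le, h.1.le]
  · refine lt_of_lt_of_le ?_ (hm n' t' x' hx')
    rcases key n' h1 (h2.le.trans hn.2) with h | h
    exacts [h, absurd h.2 (not_le.2 h2)]

/-- The right derivative at `x` in direction `v` of `y ↦ radialPrimitive R ‖y‖`. -/
def radialDeriv (R : ℝ) (x v : E) : ℝ :=
  open Classical in if x = 0 then √R * ‖v‖ else √(R - ‖x‖ ^ 2) / ‖x‖ * ⟪x, v⟫

lemma hasDerivWithinAt_radialPrimitive (R : ℝ) (x v : E) :
    HasDerivWithinAt (fun ε : ℝ => radialPrimitive R ‖x + ε • v‖) (radialDeriv R x v)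
      (Ioi 0) 0 := by
  rw [radialDeriv]
  split_ifs with hx
  · subst hx
    have h1 : HasDerivWithinAt (fun ε : ℝ => radialPrimitive R (ε * ‖v‖)) (√R * ‖v‖)
        (Ioi 0) 0 := by
      have h := (hasDerivAt_radialPrimitive R ((0 : ℝ) * ‖v‖)).comp (0 : ℝ)
        ((hasDerivAt_id (0 : ℝ)).mul_const ‖v‖)
      simpa [Function.comp_def] using h.hasDerivWithinAt
    refine h1.congr (fun ε hε => ?_) (by simp)
    rw [zero_add, norm_smul, norm_eq_abs, abs_of_pos hε]
  · have hx' : ‖x‖ ≠ 0 := norm_ne_zero_iff.2 hx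
    have h0 : HasDerivAt (fun ε : ℝ => x + ε • v) v 0 := by
      simpa using ((hasDerivAt_id (0 : ℝ)).smul_const v).const_add x
    have h1 := h0.norm_sq
    have h2 : HasDerivAt (fun ε : ℝ => ‖x + ε • v‖) (⟪x, v⟫ / ‖x‖) 0 := by
      have := h1.sqrt (by simpa using hx')
      simp only [zero_smul, add_zero, sqrt_sq (norm_nonneg _)] at this
      convert this using 1
      field_simp
    have h3 : HasDerivAt (radialPrimitive R) (√(R - ‖x‖ ^ 2)) ‖x + (0 : ℝ) • v‖ := by
      simpa using hasDerivAt_radialPrimitive R ‖x‖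
    refine (h3.comp (0 : ℝ) h2).hasDerivWithinAt.congr_deriv ?_
    ring

variable (E) in
/-- A time-periodic potential `V` on `E` with gradient `g` and time derivative `vt`, at most
`-β` on the shell `√R₀ ≤ |q| ≤ √R₁` and vanishing at the origin. -/
structure ShellPotential (R₀ R₁ β : ℝ) where
  /-- The potential. -/
  V : E × ℝ → ℝ
  /-- The spatial gradient. -/
  g : E × ℝ → E
  /-- The time derivative. -/
  vt : E × ℝ → ℝ
  hR₀ : 0 < R₀
  hR : R₀ < R₁
  hβ : 0 ≤ β
  hasFDerivAt : ∀ z, HasFDerivAt V ((innerSL ℝ (g z)).comp (ContinuousLinearMap.fst ℝ E ℝ) +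
    vt z • ContinuousLinearMap.snd ℝ E ℝ) z
  contDiff_g : ContDiff ℝ 1 g
  contDiff_vt : ContDiff ℝ 1 vt
  periodic : ∀ q t, V (q, t + 1) = V (q, t)
  le_neg : ∀ q t, √R₀ ≤ ‖q‖ → ‖q‖ ≤ √R₁ → V (q, t) ≤ -β
  at_zero : ∀ t, V (0, t) = 0

namespace ShellPotential

variable {R₀ R₁ β : ℝ}

lemma hR₁ (S : ShellPotential E R₀ R₁ β) : 0 < R₁ := S.hR₀.trans S.hR

variable (S : ShellPotential E R₀ R₁ β)

lemma continuous_V : Continuous S.V :=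
  continuous_iff_continuousAt.2 fun z => (S.hasFDerivAt z).continuousAt

/-- Discrete action of energy level `c` of the path `x 0, …, x n` with step `h` starting at
time `t`, with the generating functions of floor and ceiling as boundary terms. -/
def action (h c : ℝ) (n : ℕ) (t : ℝ) (x : ℕ → E) : ℝ :=
  radialPrimitive R₀ ‖x 0‖ + ∑ i ∈ Finset.range n,
    (‖x (i + 1) - x i‖ ^ 2 / (2 * h) + h * (c - S.V (x i, t + i * h)))
    - radialPrimitive R₁ ‖x n‖

lemma continuous_action (h c : ℝ) (n : ℕ) :
    Continuous fun z : ℝ × (ℕ → E) => S.action h c n z.1 z.2 := by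
  have := S.continuous_V
  have := continuous_radialPrimitive R₀
  have := continuous_radialPrimitive R₁
  unfold action
  fun_prop

lemma action_periodic (h c : ℝ) (n : ℕ) (t : ℝ) (x : ℕ → E) :
    S.action h c n (t + 1) x = S.action h c n t x := by
  simp only [action, add_right_comm t 1, S.periodic]

lemma action_zero (h c t : ℝ) (x : ℕ → E) : S.action h c 0 t x =
    radialPrimitive R₀ ‖x 0‖ - radialPrimitive R₁ ‖x 0‖ := by
  simp [action]

lemma action_succ (h c : ℝ) (n : ℕ) (t : ℝ) (x : ℕ → E) :
    S.action h c (n + 1) t x = S.action h c n t x +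
      ‖x (n + 1) - x n‖ ^ 2 / (2 * h) + h * (c - S.V (x n, t + n * h)) +
      radialPrimitive R₁ ‖x n‖ - radialPrimitive R₁ ‖x (n + 1)‖ := by
  simp only [action, Finset.sum_range_succ]
  ring

lemma action_level (h c c' : ℝ) (n : ℕ) (t : ℝ) (x : ℕ → E) :
    S.action h c n t x = S.action h c' n t x + (c - c') * (n * h) := by
  induction n with
  | zero => simp [action_zero]
  | succ n ih => rw [action_succ, action_succ, ih]; push_cast; ring

lemma action_split (h c : ℝ) (i m : ℕ) (t : ℝ) (x : ℕ → E) :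
    S.action h c (i + m) t x = S.action h c i t x +
      S.action h c m (t + i * h) (fun j => x (i + j)) +
      radialPrimitive R₁ ‖x i‖ - radialPrimitive R₀ ‖x i‖ := by
  induction m with
  | zero => simp only [action_zero, add_zero]; ring
  | succ m ih =>
    rw [← add_assoc, action_succ, ih, action_succ]
    simp only [← add_assoc, Nat.cast_add]
    ring_nf

lemma action_congr (h c : ℝ) (n : ℕ) (t : ℝ) {x y : ℕ → E} (hxy : ∀ i ≤ n, x i = y i) :
    S.action h c n t x = S.action h c n t y := by
  simp only [action]
  rw [hxy 0 (Nat.zero_le _), hxy n le_rfl]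
  congr 2
  refine Finset.sum_congr rfl fun i hi => ?_
  rw [Finset.mem_range] at hi
  rw [hxy i hi.le, hxy (i + 1) hi]

lemma hasDerivAt_action_time (h c : ℝ) (n : ℕ) (t : ℝ) (x : ℕ → E) :
    HasDerivAt (fun s => S.action h c n s x)
      (-(h * ∑ i ∈ Finset.range n, S.vt (x i, t + i * h))) t := by
  have h1 : ∀ i : ℕ, HasDerivAt (fun s => S.V (x i, s + i * h)) (S.vt (x i, t + i * h)) t :=
    fun i => by
      have h2 : HasDerivAt (fun s : ℝ => (x i, s + i * h)) ((0 : E), (1 : ℝ)) t :=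
        (hasDerivAt_const _ _).prodMk ((hasDerivAt_id t).add_const _)
      simpa [Function.comp_def] using (S.hasFDerivAt (x i, t + i * h)).comp_hasDerivAt t h2
  have h3 := HasDerivAt.fun_sum (u := Finset.range n) fun i _ =>
    (((h1 i).const_sub c).const_mul h).const_add (‖x (i + 1) - x i‖ ^ 2 / (2 * h))
  refine ((h3.const_add (radialPrimitive R₀ ‖x 0‖)).sub_const
    (radialPrimitive R₁ ‖x n‖)).congr_deriv ?_
  simp [Finset.mul_sum]

/-- The discrete momentum of the `i`-th step. -/
def mom (h : ℝ) (x : ℕ → E) (i : ℕ) : E := h⁻¹ • (x (i + 1) - x i)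

lemma hasDerivWithinAt_action_space {h : ℝ} (hh : 0 < h) (c : ℝ) (n : ℕ) (t : ℝ)
    (x δ : ℕ → E) :
    HasDerivWithinAt (fun ε : ℝ => S.action h c n t (fun j => x j + ε • δ j))
      (radialDeriv R₀ (x 0) (δ 0) + (∑ i ∈ Finset.range n, ⟪mom h x i, δ (i + 1)⟫ -
        ∑ i ∈ Finset.range n, ⟪mom h x i + h • S.g (x i, t + i * h), δ i⟫)
        - radialDeriv R₁ (x n) (δ n)) (Ioi 0) 0 := by
  have h0 : ∀ i, HasDerivAt (fun ε : ℝ => x i + ε • δ i) (δ i) 0 := fun i => by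
    simpa using ((hasDerivAt_id (0 : ℝ)).smul_const (δ i)).const_add (x i)
  have h1 : ∀ i : ℕ, HasDerivAt (fun ε : ℝ => S.V (x i + ε • δ i, t + i * h))
      ⟪S.g (x i, t + i * h), δ i⟫ 0 := fun i => by
    have h2 : HasDerivAt (fun ε : ℝ => (x i + ε • δ i, t + i * h)) (δ i, (0 : ℝ)) 0 :=
      (h0 i).prodMk (hasDerivAt_const _ _)
    have h3 : HasFDerivAt S.V _ (x i + (0 : ℝ) • δ i, t + i * h) := S.hasFDerivAt _
    simpa [Function.comp_def] using h3.comp_hasDerivAt (0 : ℝ) h2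
  have h2 : ∀ i : ℕ, HasDerivAt
      (fun ε : ℝ => ‖(x (i + 1) + ε • δ (i + 1)) - (x i + ε • δ i)‖ ^ 2 / (2 * h))
      ⟪mom h x i, δ (i + 1) - δ i⟫ 0 := fun i => by
    have := (((h0 (i + 1)).sub (h0 i)).norm_sq).div_const (2 * h)
    refine this.congr_deriv ?_
    simp only [Pi.sub_apply, zero_smul, add_zero, mom, real_inner_smul_left]
    field_simp
  have h3 := HasDerivAt.fun_sum (u := Finset.range n) fun i _ =>
    (h2 i).add (((h1 i).const_sub c).const_mul h)
  refine (((hasDerivWithinAt_radialPrimitive R₀ (x 0) (δ 0)).add h3.hasDerivWithinAt).sub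
    (hasDerivWithinAt_radialPrimitive R₁ (x n) (δ n))).congr_deriv ?_
  rw [← Finset.sum_sub_distrib]
  congr 2
  refine Finset.sum_congr rfl fun i _ => ?_
  rw [inner_add_left, real_inner_smul_left, inner_sub_right]
  ring

end ShellPotential

@[simp] lemma radialDeriv_zero_right (R : ℝ) (x : E) : radialDeriv R x 0 = 0 := by
  simp [radialDeriv]

lemma radialDeriv_zero_left (R : ℝ) (v : E) : radialDeriv R 0 v = √R * ‖v‖ := by
  simp [radialDeriv]

lemma radialDeriv_of_ne (R : ℝ) {x : E} (hx : x ≠ 0) (v : E) :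
    radialDeriv R x v = ⟪(√(R - ‖x‖ ^ 2) / ‖x‖) • x, v⟫ := by
  rw [radialDeriv, if_neg hx, real_inner_smul_left]

lemma sum_inner_single (a : ℕ → E) (n j : ℕ) (v : E) :
    ∑ i ∈ Finset.range n, ⟪a i, (Pi.single j v : ℕ → E) i⟫ = if j < n then ⟪a j, v⟫ else 0 := by
  have : ∀ i, ⟪a i, (Pi.single j v : ℕ → E) i⟫ = if j = i then ⟪a i, v⟫ else 0 := fun i => by
    rcases eq_or_ne j i with rfl | h
    · simp
    · simp [h, h.symm]
  simp [this]

lemma sum_inner_single_succ (a : ℕ → E) (n j : ℕ) (v : E) :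
    ∑ i ∈ Finset.range n, ⟪a i, (Pi.single (j + 1) v : ℕ → E) (i + 1)⟫ =
      if j < n then ⟪a j, v⟫ else 0 := by
  rw [← sum_inner_single]
  refine Finset.sum_congr rfl fun i _ => ?_
  simp [Pi.single_apply]

lemma eq_zero_of_forall_inner_nonneg {w : E} (hw : ∀ v : E, 0 ≤ ⟪w, v⟫) : w = 0 := by
  have := hw (-w)
  rw [inner_neg_right, real_inner_self_eq_norm_sq] at this
  exact norm_eq_zero.1 (by nlinarith [norm_nonneg w])

lemma exists_norm_add_smul_le {ρ : ℝ} {y : E} (hy : ‖y‖ < ρ) (v : E) :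
    ∃ ε₀ > (0 : ℝ), ∀ ε, 0 < ε → ε < ε₀ → ‖y + ε • v‖ ≤ ρ := by
  refine ⟨(ρ - ‖y‖) / (‖v‖ + 1), div_pos (sub_pos.2 hy) (by positivity), fun ε h0 h1 => ?_⟩
  rw [lt_div_iff₀ (by positivity)] at h1
  have := norm_add_le y (ε • v)
  rw [norm_smul, norm_eq_abs, abs_of_pos h0] at this
  nlinarith

namespace ShellPotential

variable {R₀ R₁ β : ℝ} (S : ShellPotential E R₀ R₁ β)

/-- A discrete path in the ball `|q| ≤ √R₁`, not touching the boundary at interior times, that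
minimizes the action among paths in the ball with the same number of steps and starting point. -/
structure IsMinPath (h c : ℝ) (n : ℕ) (t : ℝ) (x : ℕ → E) : Prop where
  mem : ∀ j, ‖x j‖ ≤ √R₁
  interior : ∀ i, 0 < i → i < n → ‖x i‖ < √R₁
  le : ∀ t' x', (∀ j, ‖x' j‖ ≤ √R₁) → x' 0 = x 0 → S.action h c n t x ≤ S.action h c n t' x'

variable {S} {h c : ℝ} {n : ℕ} {t : ℝ} {x : ℕ → E}

lemma variation_nonneg (hh : 0 < h) (hmem : ∀ j, ‖x j‖ ≤ √R₁) (j : ℕ) (v : E)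
    (hv : ∃ ε₀ > (0 : ℝ), ∀ ε, 0 < ε → ε < ε₀ → ‖x j + ε • v‖ ≤ √R₁)
    (hle : ∀ x', (∀ j, ‖x' j‖ ≤ √R₁) → (∀ i, i ≠ j → x' i = x i) →
      S.action h c n t x ≤ S.action h c n t x') :
    0 ≤ radialDeriv R₀ (x 0) ((Pi.single j v : ℕ → E) 0) +
      (∑ i ∈ Finset.range n, ⟪mom h x i, (Pi.single j v : ℕ → E) (i + 1)⟫ -
        if j < n then ⟪mom h x j + h • S.g (x j, t + j * h), v⟫ else 0)
        - radialDeriv R₁ (x n) ((Pi.single j v : ℕ → E) n) := by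
  obtain ⟨ε₀, hε₀, hε⟩ := hv
  have := S.hasDerivWithinAt_action_space hh c n t x (Pi.single j v)
  rw [sum_inner_single] at this
  refine this.nonneg_of_right_min hε₀ fun ε h0 h1 => ?_
  simp only [zero_smul, add_zero]
  refine hle _ (fun i => ?_) fun i hi => ?_
  · rcases eq_or_ne i j with rfl | hi
    · simpa using hε ε h0 h1
    · simpa [hi] using hmem i
  · simp [hi]

namespace IsMinPath

lemma euler_lagrange (hx : S.IsMinPath h c n t x) (hh : 0 < h) {j : ℕ} (hj : j + 1 < n) :
    mom h x (j + 1) = mom h x j - h • S.g (x (j + 1), t + (j + 1 : ℕ) * h) := by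
  have key : mom h x j - (mom h x (j + 1) + h • S.g (x (j + 1), t + (j + 1 : ℕ) * h)) = 0 :=
    eq_zero_of_forall_inner_nonneg fun v => by
      have := variation_nonneg (S := S) (n := n) (c := c) (t := t) hh hx.mem (j + 1) v
        (exists_norm_add_smul_le (hx.interior _ j.succ_pos hj) v)
        fun x' h1 h2 => hx.le t x' h1 (h2 0 (by simp))
      rw [sum_inner_single_succ, if_pos hj, if_pos (by omega)] at this
      simpa [hj.ne', inner_sub_left] using this
  rw [sub_eq_zero] at key
  rw [key]
  abel

lemma sum_vt (hx : S.IsMinPath h c n t x) (hh : 0 < h) :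
    ∑ i ∈ Finset.range n, S.vt (x i, t + i * h) = 0 := by
  have h1 : IsLocalMin (fun s => S.action h c n s x) t :=
    Filter.Eventually.of_forall fun s => hx.le s x hx.mem rfl
  have := h1.hasDerivAt_eq_zero (S.hasDerivAt_action_time h c n t x)
  simpa [hh.ne'] using this

lemma end_variation {m : ℕ} (hx : S.IsMinPath h c (m + 1) t x) (hh : 0 < h) (v : E)
    (hv : ∃ ε₀ > (0 : ℝ), ∀ ε, 0 < ε → ε < ε₀ → ‖x (m + 1) + ε • v‖ ≤ √R₁) :
    radialDeriv R₁ (x (m + 1)) v ≤ ⟪mom h x m, v⟫ := by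
  have := variation_nonneg (S := S) (n := m + 1) (c := c) (t := t) hh hx.mem (m + 1) v hv
    fun x' h1 h2 => hx.le t x' h1 (h2 0 (by simp))
  rw [sum_inner_single_succ] at this
  simpa using this

lemma end_ne_zero [Nontrivial E] {m : ℕ} (hx : S.IsMinPath h c (m + 1) t x) (hh : 0 < h) :
    x (m + 1) ≠ 0 := by
  intro h0
  obtain ⟨v, hv⟩ := exists_ne (0 : E)
  have hR : 0 < √R₁ := sqrt_pos.2 S.hR₁
  have hlt : ‖x (m + 1)‖ < √R₁ := by simpa [h0] using S.hR₁
  have h1 := hx.end_variation hh v (exists_norm_add_smul_le hlt v)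
  have h2 := hx.end_variation hh (-v) (exists_norm_add_smul_le hlt (-v))
  rw [h0, radialDeriv_zero_left] at h1 h2
  rw [inner_neg_right, norm_neg] at h2
  have := mul_pos hR (norm_pos_iff.2 hv)
  linarith

lemma end_mom [Nontrivial E] {m : ℕ} (hx : S.IsMinPath h c (m + 1) t x) (hh : 0 < h) :
    mom h x m = (√(R₁ - ‖x (m + 1)‖ ^ 2) / ‖x (m + 1)‖) • x (m + 1) := by
  have h0 := hx.end_ne_zero hh
  rcases (hx.mem (m + 1)).lt_or_eq with hlt | heq
  · rw [← sub_eq_zero]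
    refine eq_zero_of_forall_inner_nonneg fun v => ?_
    have := hx.end_variation hh v (exists_norm_add_smul_le hlt v)
    rw [radialDeriv_of_ne _ h0] at this
    rw [inner_sub_left]
    linarith
  · have h1 := hx.end_variation hh (x m - x (m + 1)) ⟨1, one_pos, fun ε h0 h1 => by
      have : x (m + 1) + ε • (x m - x (m + 1)) = (1 - ε) • x (m + 1) + ε • x m := by
        rw [smul_sub, sub_smul, one_smul]; abel
      rw [this]
      refine (norm_add_le _ _).trans ?_
      rw [norm_smul, norm_smul, norm_eq_abs, norm_eq_abs, abs_of_pos h0,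
        abs_of_pos (sub_pos.2 h1)]
      nlinarith [hx.mem m, hx.mem (m + 1)]⟩
    rw [radialDeriv_of_ne _ h0, heq, sq_sqrt S.hR₁.le, sub_self, sqrt_zero, zero_div, zero_smul,
      inner_zero_left, mom, real_inner_smul_left, ← neg_sub (x (m + 1)), inner_neg_right,
      real_inner_self_eq_norm_sq] at h1
    have h2 : ‖x (m + 1) - x m‖ = 0 := by
      have := inv_pos.2 hh
      by_contra h3
      have : 0 < ‖x (m + 1) - x m‖ := lt_of_le_of_ne (norm_nonneg _) (Ne.symm h3)
      have : 0 < h⁻¹ * ‖x (m + 1) - x m‖ ^ 2 := by positivity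
      linarith
    rw [heq, sq_sqrt S.hR₁.le, sub_self, sqrt_zero, zero_div, zero_smul, mom,
      norm_eq_zero.1 h2, smul_zero]

lemma norm_end_mom [Nontrivial E] {m : ℕ} (hx : S.IsMinPath h c (m + 1) t x) (hh : 0 < h) :
    ‖mom h x m‖ = √(R₁ - ‖x (m + 1)‖ ^ 2) := by
  have h0 : ‖x (m + 1)‖ ≠ 0 := norm_ne_zero_iff.2 (hx.end_ne_zero hh)
  rw [hx.end_mom hh, norm_smul, norm_div, norm_norm, div_mul_cancel₀ _ h0,
    norm_of_nonneg (sqrt_nonneg _)]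

lemma norm_sq_end_mom [Nontrivial E] {m : ℕ} (hx : S.IsMinPath h c (m + 1) t x) (hh : 0 < h) :
    ‖mom h x m‖ ^ 2 = R₁ - ‖x (m + 1)‖ ^ 2 := by
  rw [hx.norm_end_mom hh, sq_sqrt]
  have := pow_le_pow_left₀ (norm_nonneg _) (hx.mem (m + 1)) 2
  rw [sq_sqrt S.hR₁.le] at this
  linarith

lemma le_end_energy [Nontrivial E] {m : ℕ} (hx : S.IsMinPath h c (m + 1) t x) (hh : 0 < h)
    (hle : S.action h c (m + 1) t x ≤ S.action h c m t x) :
    c - R₁ * √(3 * h) ≤ ‖mom h x m‖ ^ 2 / 2 + S.V (x m, t + m * h) := by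
  have h0 : ‖x (m + 1)‖ ≠ 0 := norm_ne_zero_iff.2 (hx.end_ne_zero hh)
  have h1 : x (m + 1) - x m = h • mom h x m := by rw [mom, smul_inv_smul₀ hh.ne']
  have h2 : ‖x m‖ = |‖x (m + 1)‖ - h * √(R₁ - ‖x (m + 1)‖ ^ 2)| := by
    have h3 : x m = ((‖x (m + 1)‖ - h * √(R₁ - ‖x (m + 1)‖ ^ 2)) / ‖x (m + 1)‖) • x (m + 1) := by
      rw [sub_div, div_self h0, sub_smul, one_smul, mul_div_assoc, mul_smul, ← hx.end_mom hh, ← h1]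
      abel
    rw [h3, norm_smul, norm_div, norm_norm, div_mul_cancel₀ _ h0, norm_eq_abs]
  rw [action_succ, h1, h2, norm_smul, norm_of_nonneg hh.le] at hle
  have h4 := radialPrimitive_sub_back_le (norm_nonneg _) (hx.mem (m + 1)) S.hR₁ hh
  rw [← hx.norm_sq_end_mom hh] at h4
  have h5 : (h * ‖mom h x m‖) ^ 2 / (2 * h) = h * (‖mom h x m‖ ^ 2 / 2) := by field_simp
  rw [h5, show ‖mom h x m‖ ^ 2 = R₁ - ‖x (m + 1)‖ ^ 2 from hx.norm_sq_end_mom hh] at hle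
  rw [hx.norm_sq_end_mom hh] at h4 ⊢
  refine le_of_mul_le_mul_left ?_ hh
  linarith

end IsMinPath

end ShellPotential

namespace ShellPotential

variable {R₀ R₁ β : ℝ} {S : ShellPotential E R₀ R₁ β} {h c : ℝ} {n : ℕ} {t : ℝ} {x : ℕ → E}

lemma IsMinPath.end_energy_le [Nontrivial E] {m : ℕ} (hx : S.IsMinPath h c (m + 1) t x)
    (hh : 0 < h) (hh1 : h ≤ 1)
    (hle : ∀ x', (∀ j, ‖x' j‖ ≤ √R₁) → x' 0 = x 0 →
      S.action h c (m + 1) t x ≤ S.action h c (m + 2) t x') :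
    ‖mom h x m‖ ^ 2 / 2 + S.V (x (m + 1), t + (m + 1 : ℕ) * h) ≤ c + R₁ * √(3 * h) := by
  have h0 : 0 < ‖x (m + 1)‖ := norm_pos_iff.2 (hx.end_ne_zero hh)
  set r := ‖x (m + 1)‖ with hr
  set p := √(R₁ - r ^ 2) with hp
  have hrR : r ≤ √R₁ := hx.mem _
  have hp0 : 0 ≤ p := sqrt_nonneg _
  have hpp : p ^ 2 = R₁ - r ^ 2 := by rw [← hx.norm_sq_end_mom hh, hx.norm_end_mom hh]
  set r' := min (r + h * p) (√R₁) with hr'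
  have hr'r : r ≤ r' := le_min (by nlinarith) hrR
  have hf : radialPrimitive R₁ r' = radialPrimitive R₁ (r + h * p) := by
    rcases le_total (r + h * p) (√R₁) with h1 | h1
    · rw [hr', min_eq_left h1]
    · rw [hr', min_eq_right h1, radialPrimitive_sqrt S.hR₁, radialPrimitive_of_le S.hR₁ h1]
  have hn : ‖(r' / r) • x (m + 1)‖ = r' := by
    rw [norm_smul, norm_of_nonneg (div_nonneg (h0.le.trans hr'r) h0.le), ← hr,
      div_mul_cancel₀ _ h0.ne']
  have hd : ‖(r' / r) • x (m + 1) - x (m + 1)‖ = r' - r := by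
    rw [show (r' / r) • x (m + 1) - x (m + 1) = (r' / r - 1) • x (m + 1) by
      rw [sub_smul, one_smul], norm_smul, norm_of_nonneg, ← hr, sub_mul, div_mul_cancel₀ _ h0.ne',
      one_mul]
    rw [sub_nonneg, one_le_div h0]
    exact hr'r
  have h1 := hle (Function.update x (m + 2) ((r' / r) • x (m + 1))) (fun j => by
    rcases eq_or_ne j (m + 2) with rfl | hj
    · rw [Function.update_self, hn]; exact min_le_right _ _
    · rw [Function.update_of_ne hj]; exact hx.mem j) (by simp)
  rw [S.action_succ h c (m + 1), Function.update_self,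
    Function.update_of_ne (by omega), hn, hd, ← hr,
    S.action_congr h c (m + 1) t (x := Function.update x (m + 2) _) (y := x)
      fun i hi => Function.update_of_ne (by omega) _ _, hf] at h1
  have h2 := le_radialPrimitive_sub_forward h0.le hrR S.hR₁ hh hh1
  rw [← hp] at h2
  have h3 : (r' - r) ^ 2 / (2 * h) ≤ h * (p ^ 2 / 2) := by
    have h4 : r' - r ≤ h * p := by linarith [min_le_left (r + h * p) (√R₁)]
    calc (r' - r) ^ 2 / (2 * h) ≤ (h * p) ^ 2 / (2 * h) := by
          have := sub_nonneg.2 hr'r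
          gcongr
      _ = h * (p ^ 2 / 2) := by field_simp
  rw [hx.norm_end_mom hh, ← hr, ← hp]
  refine le_of_mul_le_mul_left ?_ hh
  rw [hpp] at h3 ⊢
  linarith

lemma start_variation {m : ℕ} (hh : 0 < h) (hmem : ∀ j, ‖x j‖ ≤ √R₁) (hlt : ‖x 0‖ < √R₁)
    (hle : ∀ x', (∀ j, ‖x' j‖ ≤ √R₁) →
      S.action h c (m + 1) t x ≤ S.action h c (m + 1) t x') (v : E) :
    ⟪mom h x 0 + h • S.g (x 0, t), v⟫ ≤ radialDeriv R₀ (x 0) v := by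
  have := variation_nonneg (S := S) (n := m + 1) (c := c) (t := t) hh hmem 0 v
    (exists_norm_add_smul_le hlt v) fun x' h1 _ => hle x' h1
  simpa [Pi.single_apply] using this

lemma start_norm_lt {m : ℕ} (hh : 0 < h) (hmem : ∀ j, ‖x j‖ ≤ √R₁) (hc : -β < c)
    (hle : S.action h c (m + 1) t x ≤ S.action h c m (t + h) fun j => x (1 + j)) :
    ‖x 0‖ < √R₀ := by
  by_contra! h0
  have h1 := S.action_split h c 1 m t x
  rw [S.action_succ h c 0, action_zero, add_comm 1 m] at h1
  simp only [Nat.cast_one, one_mul, zero_add, Nat.cast_zero, zero_mul, add_zero] at h1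
  have h2 := S.le_neg (x 0) t h0 (hmem 0)
  have h3 := radialPrimitive_of_le S.hR₀ h0
  have h4 := radialPrimitive_le (r := ‖x 1‖) S.hR₀
  have h5 : 0 ≤ ‖x 1 - x 0‖ ^ 2 / (2 * h) := by positivity
  have h6 : 0 < h * (c - S.V (x 0, t)) := mul_pos hh (by linarith)
  linarith

end ShellPotential

namespace ShellPotential

variable {R₀ R₁ β : ℝ} (S : ShellPotential E R₀ R₁ β) {h c : ℝ} {n : ℕ} {t : ℝ} {x : ℕ → E}

/-- A symplectic Euler trajectory `(P i, x i)` of step `h` with balanced energy, ending on the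
ceiling, which starts on the floor or, up to an energy error, at `x 0 = 0`, `|P 0| = √R₀`. -/
structure IsDiscreteChord (h : ℝ) (n : ℕ) (t : ℝ) (P x : ℕ → E) : Prop where
  pos : 0 < n
  mem : ∀ j, ‖x j‖ ≤ √R₁
  step_P : ∀ i < n, P (i + 1) = P i - h • S.g (x i, t + i * h)
  step_x : ∀ i < n, x (i + 1) = x i + h • P (i + 1)
  sum_vt : ∑ i ∈ Finset.range n, S.vt (x i, t + i * h) = 0
  end_ne : x n ≠ 0
  end_P : P n = (√(R₁ - ‖x n‖ ^ 2) / ‖x n‖) • x n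
  start : (x 0 ≠ 0 ∧ ‖x 0‖ ≤ √R₀ ∧ P 0 = (√(R₀ - ‖x 0‖ ^ 2) / ‖x 0‖) • x 0) ∨
    (x 0 = 0 ∧ R₀ / 2 - R₁ * √(3 * h) ≤ ‖P n‖ ^ 2 / 2 + S.V (x n - h • P n, t + n * h - h) ∧
      (‖P 0‖ ≤ √R₀ ∨ ‖P n‖ ^ 2 / 2 + S.V (x n, t + n * h) ≤ R₀ / 2 + R₁ * √(3 * h)))

variable {S}

/-- The momenta of a discrete path, including the initial one. -/
def momenta (S : ShellPotential E R₀ R₁ β) (h t : ℝ) (x : ℕ → E) : ℕ → E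
  | 0 => mom h x 0 + h • S.g (x 0, t)
  | i + 1 => mom h x i

lemma add_smul_mom (hh : 0 < h) (i : ℕ) : x i + h • mom h x i = x (i + 1) := by
  rw [mom, smul_inv_smul₀ hh.ne']
  abel

lemma IsMinPath.isDiscreteChord [Nontrivial E] {m : ℕ} (hx : S.IsMinPath h c (m + 1) t x)
    (hh : 0 < h)
    (hstart : (x 0 ≠ 0 ∧ ‖x 0‖ ≤ √R₀ ∧
        mom h x 0 + h • S.g (x 0, t) = (√(R₀ - ‖x 0‖ ^ 2) / ‖x 0‖) • x 0) ∨
      (x 0 = 0 ∧ R₀ / 2 - R₁ * √(3 * h) ≤ ‖mom h x m‖ ^ 2 / 2 + S.V (x m, t + m * h) ∧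
      (‖mom h x 0 + h • S.g (x 0, t)‖ ≤ √R₀ ∨
        ‖mom h x m‖ ^ 2 / 2 + S.V (x (m + 1), t + (m + 1 : ℕ) * h) ≤
          R₀ / 2 + R₁ * √(3 * h)))) :
    S.IsDiscreteChord h (m + 1) t (momenta S h t x) x where
  pos := m.succ_pos
  mem := hx.mem
  step_P i hi := by
    cases i with
    | zero => simp [momenta]
    | succ i => exact hx.euler_lagrange hh hi
  step_x i hi := (add_smul_mom hh i).symm
  sum_vt := hx.sum_vt hh
  end_ne := hx.end_ne_zero hh
  end_P := hx.end_mom hh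
  start := by
    have h1 : x (m + 1) - h • mom h x m = x m := by rw [← add_smul_mom (x := x) hh m]; abel
    have h2 : t + (m + 1 : ℕ) * h - h = t + m * h := by push_cast; ring
    simpa only [momenta, h1, h2] using hstart

lemma IsMinPath.level (hx : S.IsMinPath h c n t x) (c' : ℝ) : S.IsMinPath h c' n t x where
  mem := hx.mem
  interior := hx.interior
  le t' x' h1 h2 := by
    have := hx.le t' x' h1 h2
    rw [S.action_level h c' c, S.action_level h c' c n t' x']
    linarith

lemma le_action_zero (S : ShellPotential E R₀ R₁ β) (h c t : ℝ) (x : ℕ → E)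
    (hx : ‖x 0‖ ≤ √R₁) : -(π * (R₁ - R₀) / 4) ≤ S.action h c 0 t x := by
  rw [action_zero]
  linarith [radialPrimitive_sub_radialPrimitive_le S.hR₀ S.hR hx]

lemma action_split_of_eq (S : ShellPotential E R₀ R₁ β) (h c t : ℝ) {x : ℕ → E} {i n : ℕ}
    (hin : i ≤ n) (hi : ‖x i‖ = √R₁) :
    S.action h c n t x = S.action h c i t x +
      S.action h c (n - i) (t + i * h) (fun j => x (i + j)) + π * (R₁ - R₀) / 4 := by
  obtain ⟨m, rfl⟩ := Nat.exists_eq_add_of_le hin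
  rw [action_split, Nat.add_sub_cancel_left, hi, radialPrimitive_sqrt S.hR₁,
    radialPrimitive_of_le S.hR₀ (sqrt_le_sqrt S.hR.le)]
  ring

lemma isCompact_box [FiniteDimensional ℝ E] (ρ : ℝ) :
    IsCompact {x : ℕ → E | ∀ j, ‖x j‖ ≤ ρ} := by
  have := isCompact_univ_pi fun _ : ℕ => isCompact_closedBall (0 : E) ρ
  simpa [Set.pi] using this

/-- There is a critical energy level at which the minimal action is attained and equals minus
the area of the tetragon. -/
lemma exists_critical_level [FiniteDimensional ℝ E] (S : ShellPotential E R₀ R₁ β)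
    (hh : 0 < h) {N : ℕ} (hN : 1 ≤ N) :
    ∃ c n t x, 1 ≤ n ∧ n ≤ N ∧ t ∈ Icc (0 : ℝ) 1 ∧ (∀ j, ‖x j‖ ≤ √R₁) ∧
      S.action h c n t x = -(π * (R₁ - R₀) / 4) ∧
      (∀ n' t' x', (∀ j, ‖x' j‖ ≤ √R₁) → n' ≤ N →
        -(π * (R₁ - R₀) / 4) ≤ S.action h c n' t' x') ∧
      (∀ n' t' x', (∀ j, ‖x' j‖ ≤ √R₁) → 1 ≤ n' → n' < n →
        -(π * (R₁ - R₀) / 4) < S.action h c n' t' x') := by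
  obtain ⟨n, t, x, hx, h1, h2, ht, hle, hlt⟩ := exists_lex_min
    (fun n t x => (S.action h 0 n t x + π * (R₁ - R₀) / 4) / (n * h))
    (isCompact_box (E := E) (√R₁)) ⟨0, fun j => by simp⟩
    (fun n => ((S.continuous_action h 0 n).add_const _).div_const _)
    (fun n t x => by rw [action_periodic]) hN
  set d := (S.action h 0 n t x + π * (R₁ - R₀) / 4) / (n * h) with hd
  have hlevel : ∀ n' t' x', S.action h (-d) n' t' x' = S.action h 0 n' t' x' - d * (n' * h) :=
    fun n' t' x' => by rw [S.action_level h (-d) 0]; ring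
  have hpos : ∀ n' : ℕ, 1 ≤ n' → 0 < (n' : ℝ) * h := fun n' hn' =>
    mul_pos (by exact_mod_cast hn') hh
  refine ⟨-d, n, t, x, h1, h2, ht, hx, ?_, fun n' t' x' hx' h3 => ?_,
    fun n' t' x' hx' h3 h4 => ?_⟩
  · rw [hlevel, hd, div_mul_cancel₀ _ (hpos n h1).ne']
    ring
  · rcases Nat.eq_zero_or_pos n' with rfl | h4
    · exact le_action_zero S _ _ _ _ (hx' 0)
    · have := hle n' t' x' hx' h4 h3
      rw [le_div_iff₀ (hpos n' h4)] at this
      rw [hlevel]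
      linarith
  · have := hlt n' t' x' hx' h3 h4
    rw [lt_div_iff₀ (hpos n' h3)] at this
    rw [hlevel]
    linarith

/-- The minimizer of the action among paths starting at the origin. -/
lemma exists_minimizer_origin [FiniteDimensional ℝ E] (S : ShellPotential E R₀ R₁ β)
    (h c : ℝ) (N : ℕ) :
    ∃ n t x, n ≤ N ∧ t ∈ Icc (0 : ℝ) 1 ∧ (∀ j, ‖x j‖ ≤ √R₁) ∧ x 0 = 0 ∧
      (∀ n' t' x', (∀ j, ‖x' j‖ ≤ √R₁) → x' 0 = 0 → n' ≤ N →
        S.action h c n t x ≤ S.action h c n' t' x') ∧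
      (∀ n' t' x', (∀ j, ‖x' j‖ ≤ √R₁) → x' 0 = 0 → n' < n →
        S.action h c n t x < S.action h c n' t' x') := by
  have hcl : IsClosed {x : ℕ → E | x 0 = 0} :=
    isClosed_eq (continuous_apply 0) continuous_const
  obtain ⟨n, t, x, hx, -, h2, ht, hle, hlt⟩ := exists_lex_min (fun n t x => S.action h c n t x)
    ((isCompact_box (E := E) (√R₁)).inter_right hcl) ⟨0, fun j => by simp, rfl⟩
    (fun n => S.continuous_action h c n)
    (fun n t x => by rw [action_periodic]) (Nat.zero_le N)
  exact ⟨n, t, x, h2, ht, hx.1, hx.2, fun n' t' x' h3 h4 h5 => hle n' t' x' ⟨h3, h4⟩ zero_le h5,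
    fun n' t' x' h3 h4 h5 => hlt n' t' x' ⟨h3, h4⟩ zero_le h5⟩

lemma exists_action_neg [Nontrivial E] (S : ShellPotential E R₀ R₁ β) (hh : 0 < h)
    (hh1 : h ≤ 1) (hhR : h * R₁ < (R₁ - R₀) / 2) :
    ∃ x : ℕ → E, (∀ j, ‖x j‖ ≤ √R₁) ∧ x 0 = 0 ∧ S.action h (R₀ / 2) 1 0 x < 0 := by
  obtain ⟨e, he⟩ := exists_norm_eq E (zero_le_one' ℝ)
  have hR := S.hR₁
  have hn : ‖(h * √R₁) • e‖ = h * √R₁ := by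
    rw [norm_smul, he, mul_one, norm_of_nonneg (by positivity)]
  refine ⟨fun j => if j = 0 then 0 else (h * √R₁) • e, fun j => ?_, rfl, ?_⟩
  · dsimp only
    split_ifs
    · simp
    · rw [hn]
      exact mul_le_of_le_one_left (sqrt_nonneg _) hh1
  · have h1 := mul_le_radialPrimitive (R := R₁) (r := h * √R₁) (by positivity)
    have h2 : √R₁ * (1 - h) ≤ √(R₁ - (h * √R₁) ^ 2) := by
      refine le_sqrt_of_sq_le ?_
      rw [mul_pow, mul_pow, sq_sqrt hR.le]
      nlinarith [mul_nonneg hR.le (mul_nonneg hh.le (sub_nonneg.2 hh1))]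
    have h3 : R₁ * (1 - h) * h ≤ radialPrimitive R₁ (h * √R₁) := by
      refine le_trans ?_ h1
      calc R₁ * (1 - h) * h = √R₁ * (1 - h) * (h * √R₁) := by
            linear_combination (-(1 - h) * h) * mul_self_sqrt hR.le
        _ ≤ _ := by gcongr
    have h4 : (h * √R₁) ^ 2 / (2 * h) = h * R₁ / 2 := by
      rw [mul_pow, sq_sqrt hR.le]
      field_simp
    rw [S.action_succ h _ 0, action_zero]
    simp [hn, h4, S.at_zero]
    nlinarith [mul_lt_mul_of_pos_left hhR hh]

lemma exists_isDiscreteChord [FiniteDimensional ℝ E] [Nontrivial E]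
    (S : ShellPotential E R₀ R₁ β) (hh : 0 < h) (hh1 : h ≤ 1) (hhR : h * R₁ < (R₁ - R₀) / 2)
    {N : ℕ} (hN : 1 ≤ N) (hNh : N * h * (R₀ / 2 + β) = π * (R₁ - R₀) / 4) :
    ∃ n t P x, n ≤ N ∧ t ∈ Icc (0 : ℝ) 1 ∧ S.IsDiscreteChord h n t P x := by
  have hA : 0 < π * (R₁ - R₀) / 4 := by
    have := mul_pos pi_pos (sub_pos.2 S.hR)
    linarith
  obtain ⟨c, n, t, x, hn, hnN, ht, hx, heq, hle, hlt⟩ := exists_critical_level S hh hN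
  have hmin : S.IsMinPath h c n t x :=
    { mem := hx
      interior := fun i h0 hi => lt_of_le_of_ne (hx i) fun hi' => by
        have h1 := action_split_of_eq S h c t hi.le hi'
        have h2 := hlt i t x hx h0 hi
        have h3 := hle (n - i) (t + i * h) (fun j => x (i + j)) (fun j => hx _)
          ((Nat.sub_le _ _).trans hnN)
        linarith
      le := fun t' x' hx' _ => heq.trans_le (hle n t' x' hx' hnN) }
  obtain ⟨m, rfl⟩ : ∃ m, n = m + 1 := ⟨n - 1, by omega⟩
  have caseCritical : -β < c → (x 0 = 0 →
      R₀ / 2 - R₁ * √(3 * h) ≤ ‖mom h x m‖ ^ 2 / 2 + S.V (x m, t + m * h)) →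
      ∃ n t P x, n ≤ N ∧ t ∈ Icc (0 : ℝ) 1 ∧ S.IsDiscreteChord h n t P x := fun hc henergy => by
    have h0 : ‖x 0‖ < √R₀ := start_norm_lt hh hx hc
      (heq.trans_le (hle m _ _ (fun j => hx _) (by omega)))
    have h1 := start_variation hh hx (h0.trans (sqrt_lt_sqrt S.hR₀.le S.hR))
      fun x' hx' => heq.trans_le (hle (m + 1) t x' hx' hnN)
    refine ⟨m + 1, t, _, x, hnN, ht, hmin.isDiscreteChord hh ?_⟩
    by_cases hx0 : x 0 = 0
    · refine Or.inr ⟨hx0, henergy hx0, Or.inl ?_⟩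
      have h2 := h1 (mom h x 0 + h • S.g (x 0, t))
      rw [real_inner_self_eq_norm_sq, hx0, radialDeriv_zero_left, sq, ← hx0] at h2
      rcases (norm_nonneg (mom h x 0 + h • S.g (x 0, t))).eq_or_lt with h3 | h3
      · rw [← h3]; exact sqrt_nonneg _
      · exact le_of_mul_le_mul_right h2 h3
    · refine Or.inl ⟨hx0, h0.le, ?_⟩
      rw [← sub_eq_zero, ← neg_eq_zero, neg_sub]
      refine eq_zero_of_forall_inner_nonneg fun v => ?_
      have h2 := h1 v
      rw [radialDeriv_of_ne _ hx0] at h2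
      rw [inner_sub_left]
      linarith
  rcases le_or_gt (R₀ / 2) c with hc | hc
  · refine caseCritical (by linarith [S.hβ, S.hR₀]) fun _ => ?_
    have := hmin.le_end_energy hh (heq.trans_le (hle m t x hx (by omega)))
    linarith
  obtain ⟨n', t', x', hn', ht', hx', hx'0, hle', hlt'⟩ :=
    exists_minimizer_origin S h (R₀ / 2) N
  have hmin' : S.IsMinPath h (R₀ / 2) n' t' x' :=
    { mem := hx'
      interior := fun i h0 hi => lt_of_le_of_ne (hx' i) fun hi' => by
        have h1 := action_split_of_eq S h (R₀ / 2) t' hi.le hi'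
        have h2 := hlt' i t' x' hx' hx'0 hi
        have h3 := hle (n' - i) (t' + i * h) (fun j => x' (i + j)) (fun j => hx' _)
          ((Nat.sub_le _ _).trans hn')
        have h4 := S.action_level h (R₀ / 2) c (n' - i) (t' + i * h) (fun j => x' (i + j))
        have h5 : 0 ≤ (R₀ / 2 - c) * ((n' - i : ℕ) * h) :=
          mul_nonneg (sub_nonneg.2 hc.le) (by positivity)
        linarith
      le := fun t'' x'' h1 h2 => hle' n' t'' x'' h1 (h2.trans hx'0) hn' }
  have hneg : S.action h (R₀ / 2) n' t' x' < 0 := by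
    obtain ⟨y, hy, hy0, hneg⟩ := exists_action_neg S hh hh1 hhR
    exact (hle' 1 0 y hy hy0 hN).trans_lt hneg
  obtain ⟨m', rfl⟩ : ∃ m', n' = m' + 1 := by
    refine Nat.exists_eq_succ_of_ne_zero fun h0 => ?_
    subst h0
    simp [action_zero, hx'0] at hneg
  rcases hn'.lt_or_eq with hlt'' | hN'
  · refine ⟨m' + 1, t', _, x', hn', ht', hmin'.isDiscreteChord hh (Or.inr ⟨hx'0, ?_, Or.inr ?_⟩)⟩
    · exact hmin'.le_end_energy hh (hlt' m' t' x' hx' hx'0 (by omega)).le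
    · exact hmin'.end_energy_le hh hh1 fun y hy hy0 =>
        hle' (m' + 2) t' y hy (hy0.trans hx'0) hlt''
  · have h1 := hle (m' + 1) t' x' hx' hn'
    have h2 := S.action_level h (R₀ / 2) c (m' + 1) t' x'
    rw [hN'] at h1 h2 hneg
    refine caseCritical ?_ fun hx0 => ?_
    · have h3 : 0 < (N : ℝ) * h := mul_pos (by exact_mod_cast hN) hh
      have h4 : (-β - c) * (N * h) < 0 := by nlinarith
      have := neg_of_mul_neg_left h4 h3.le
      linarith
    · refine (hmin.level (R₀ / 2)).le_end_energy hh ?_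
      have h3 := S.action_level h (R₀ / 2) c (m + 1) t x
      have h4 := hle' m t x hx hx0 (by omega)
      rw [hN'] at h4
      have h5 : ((m + 1 : ℕ) : ℝ) * h ≤ N * h := by gcongr
      nlinarith

end ShellPotential

/-- Discrete Grönwall inequality. -/
lemma le_exp_of_euler_recursion {e : ℕ → ℝ} {l a : ℝ} (hl : 0 ≤ l) (ha : 0 ≤ a) (h0 : 0 ≤ e 0)
    {n : ℕ} (he : ∀ i < n, e (i + 1) ≤ (1 + l) * e i + a) : e n ≤ (e 0 + n * a) * exp (n * l) := by
  induction n with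
  | zero => simp
  | succ n ih =>
    have h1 := ih fun i hi => he i (by omega)
    have h2 := he n (by omega)
    have h3 : exp ((n + 1 : ℕ) * l) = exp l * exp (n * l) := by
      rw [← exp_add]; push_cast; ring_nf
    have h4 : 1 + l ≤ exp l := by linarith [add_one_le_exp l]
    have h5 : 1 ≤ exp l * exp (n * l) := by
      rw [← h3]; exact one_le_exp (by positivity)
    have h6 : 0 ≤ (e 0 + n * a) * exp (n * l) := by positivity
    calc e (n + 1) ≤ (1 + l) * e n + a := h2
      _ ≤ (1 + l) * ((e 0 + n * a) * exp (n * l)) + a := by gcongr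
      _ ≤ exp l * ((e 0 + n * a) * exp (n * l)) + a * (exp l * exp (n * l)) := by
          gcongr
          exact le_mul_of_one_le_right ha h5
      _ = _ := by rw [h3]; push_cast; ring

variable {F : Type*} [NormedAddCommGroup F] [NormedSpace ℝ F]

/-- Local truncation error of one Euler step. -/
lemma norm_euler_step_le {X : ℝ × F → F} {Γ : ℝ → F} {K : Set (ℝ × F)} {L : ℝ≥0} {M s h : ℝ}
    (hh : 0 ≤ h) (hM : 0 ≤ M) (hL : LipschitzOnWith L X K) (hb : ∀ z ∈ K, ‖X z‖ ≤ M)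
    (hΓ : ∀ u ∈ Icc s (s + h), HasDerivAt Γ (X (u, Γ u)) u)
    (hK : ∀ u ∈ Icc s (s + h), (u, Γ u) ∈ K) :
    ‖Γ (s + h) - Γ s - h • X (s, Γ s)‖ ≤ L * (1 + M) * h * h := by
  have hs : s ∈ Icc s (s + h) := ⟨le_rfl, by linarith⟩
  have hsh : s + h ∈ Icc s (s + h) := ⟨by linarith, le_rfl⟩
  have h1 : ∀ u ∈ Icc s (s + h), ‖Γ u - Γ s‖ ≤ M * ‖u - s‖ := fun u hu =>
    (convex_Icc s (s + h)).norm_image_sub_le_of_norm_hasDerivWithin_le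
      (fun v hv => (hΓ v hv).hasDerivWithinAt) (fun v hv => hb _ (hK v hv)) hs hu
  have h2 : ∀ u ∈ Icc s (s + h), ‖X (u, Γ u) - X (s, Γ s)‖ ≤ L * (1 + M) * h := fun u hu => by
    have h3 := hL.dist_le_mul _ (hK u hu) _ (hK s hs)
    rw [dist_eq_norm, Prod.dist_eq, dist_eq_norm, dist_eq_norm] at h3
    refine h3.trans ?_
    rw [mul_assoc]
    refine mul_le_mul_of_nonneg_left ?_ L.coe_nonneg
    have h4 : ‖u - s‖ ≤ h := by
      rw [norm_of_nonneg (sub_nonneg.2 hu.1)]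
      linarith [hu.2]
    refine max_le ?_ ?_
    · nlinarith
    · refine (h1 u hu).trans ?_
      nlinarith
  have h5 : ∀ u ∈ Icc s (s + h), HasDerivWithinAt (fun u => Γ u - u • X (s, Γ s))
      (X (u, Γ u) - X (s, Γ s)) (Icc s (s + h)) u := fun u hu => by
    simpa [Pi.sub_def] using ((hΓ u hu).sub ((hasDerivAt_id u).smul_const (X (s, Γ s)))
      ).hasDerivWithinAt
  have h6 := (convex_Icc s (s + h)).norm_image_sub_le_of_norm_hasDerivWithin_le h5 h2 hs hsh
  rw [add_sub_cancel_left, norm_of_nonneg hh] at h6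
  convert h6 using 2
  rw [add_smul]
  abel

/-- Global error of a perturbed Euler scheme. -/
lemma norm_euler_sub_le {X : ℝ × F → F} {Γ : ℝ → F} {K : Set (ℝ × F)} {L : ℝ≥0} {M C t h : ℝ}
    {n : ℕ} {Z : ℕ → F} (hh : 0 ≤ h) (hM : 0 ≤ M) (hC : 0 ≤ C) (hL : LipschitzOnWith L X K)
    (hb : ∀ z ∈ K, ‖X z‖ ≤ M)
    (hΓ : ∀ u ∈ Icc t (t + n * h), HasDerivAt Γ (X (u, Γ u)) u)
    (hK : ∀ u ∈ Icc t (t + n * h), (u, Γ u) ∈ K)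
    (hZ : ∀ i < n, (t + i * h, Z i) ∈ K)
    (hstep : ∀ i < n, ‖Z (i + 1) - Z i - h • X (t + i * h, Z i)‖ ≤ C * h * h) :
    ‖Z n - Γ (t + n * h)‖ ≤
      (‖Z 0 - Γ t‖ + (n * h) * ((C + L * (1 + M)) * h)) * exp (L * (n * h)) := by
  have key := le_exp_of_euler_recursion (e := fun i => ‖Z i - Γ (t + i * h)‖) (l := L * h)
    (a := (C + L * (1 + M)) * h * h) (n := n) (by positivity) (by positivity) (norm_nonneg _)
    fun i hi => by
      have hsub : Icc (t + i * h) (t + i * h + h) ⊆ Icc t (t + n * h) := by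
        have h1 : ((i + 1 : ℕ) : ℝ) * h ≤ n * h := by
          have : i + 1 ≤ n := hi
          gcongr
        push_cast at h1
        have h2 : 0 ≤ (i : ℝ) * h := by positivity
        exact Icc_subset_Icc (by linarith) (by linarith)
      have h1 := norm_euler_step_le hh hM hL hb (fun u hu => hΓ u (hsub hu))
        fun u hu => hK u (hsub hu)
      have h2 := hL.norm_sub_le (hZ i hi) (hK (t + i * h) (hsub ⟨le_rfl, by linarith⟩))
      rw [Prod.mk_sub_mk, sub_self, Prod.norm_mk, norm_zero, max_eq_right (norm_nonneg _)] at h2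
      have h3 : Z (i + 1) - Γ (t + (i + 1 : ℕ) * h) = (Z i - Γ (t + i * h)) +
          h • (X (t + i * h, Z i) - X (t + i * h, Γ (t + i * h))) +
          (Z (i + 1) - Z i - h • X (t + i * h, Z i)) -
          (Γ (t + i * h + h) - Γ (t + i * h) - h • X (t + i * h, Γ (t + i * h))) := by
        rw [show t + (i + 1 : ℕ) * h = t + i * h + h by push_cast; ring, smul_sub]
        abel
      have h4 : ‖h • (X (t + i * h, Z i) - X (t + i * h, Γ (t + i * h)))‖ ≤
          L * h * ‖Z i - Γ (t + i * h)‖ := by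
        rw [norm_smul, norm_of_nonneg hh]
        linarith [mul_le_mul_of_nonneg_left h2 hh]
      simp only [h3]
      refine (norm_sub_le _ _).trans ?_
      have h5 := norm_add₃_le (a := Z i - Γ (t + i * h))
        (b := h • (X (t + i * h, Z i) - X (t + i * h, Γ (t + i * h))))
        (c := Z (i + 1) - Z i - h • X (t + i * h, Z i))
      linarith [hstep i hi]
  simp only [Nat.cast_zero, zero_mul, add_zero] at key
  refine key.trans_eq ?_
  congr 2 <;> ring

/-- Convergence of bounded perturbed Euler schemes to the solution of the equation. -/
lemma tendsto_euler [FiniteDimensional ℝ F] {X : ℝ × F → F} (hX : ContDiff ℝ 1 X) {Γ : ℝ → F}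
    (hΓ : ∀ u, HasDerivAt Γ (X (u, Γ u)) u) {t h : ℕ → ℝ} {n : ℕ → ℕ} {Z : ℕ → ℕ → F}
    {T C ρ t' τ : ℝ} (hC : 0 ≤ C) (hh : ∀ k, 0 ≤ h k) (ht : ∀ k, t k ∈ Icc 0 1)
    (hn : ∀ k, n k * h k ≤ T) (hZ : ∀ k, ∀ i < n k, ‖Z k i‖ ≤ ρ)
    (hstep : ∀ k, ∀ i < n k,
      ‖Z k (i + 1) - Z k i - h k • X (t k + i * h k, Z k i)‖ ≤ C * h k * h k)
    (hlim_h : Filter.Tendsto h Filter.atTop (𝓝 0))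
    (hlim_t : Filter.Tendsto t Filter.atTop (𝓝 t'))
    (hlim_n : Filter.Tendsto (fun k => n k * h k) Filter.atTop (𝓝 τ))
    (hlim_Z : Filter.Tendsto (fun k => Z k 0) Filter.atTop (𝓝 (Γ t'))) :
    Filter.Tendsto (fun k => Z k (n k)) Filter.atTop (𝓝 (Γ (t' + τ))) := by
  have hcont : Continuous Γ := continuous_iff_continuousAt.2 fun u => (hΓ u).continuousAt
  obtain ⟨B, hB⟩ := (isCompact_Icc (a := (0 : ℝ)) (b := 1 + T)).exists_bound_of_continuousOn
    hcont.continuousOn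
  set K : Set (ℝ × F) := Icc 0 (1 + T) ×ˢ Metric.closedBall 0 (max ρ B) with hKdef
  have hKc : IsCompact K := isCompact_Icc.prod (isCompact_closedBall _ _)
  obtain ⟨L, hL⟩ := hX.contDiffOn.exists_lipschitzOnWith (s := K) one_ne_zero
    ((convex_Icc _ _).prod (convex_closedBall _ _)) hKc
  obtain ⟨M, hM⟩ := hKc.exists_bound_of_continuousOn hX.continuous.continuousOn
  have hnh : ∀ k, ∀ i ≤ n k, t k + i * h k ∈ Icc 0 (1 + T) := fun k i hi => by
    have h1 : (i : ℝ) * h k ≤ n k * h k := by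
      have := hh k
      gcongr
    have h2 : 0 ≤ (i : ℝ) * h k := mul_nonneg (Nat.cast_nonneg _) (hh k)
    exact ⟨by linarith [(ht k).1], by linarith [(ht k).2, hn k]⟩
  have key : ∀ k, ‖Z k (n k) - Γ (t k + n k * h k)‖ ≤
      (‖Z k 0 - Γ (t k)‖ + (n k * h k) * ((C + L * (1 + max M 0)) * h k)) *
        exp (L * (n k * h k)) := fun k => by
    refine norm_euler_sub_le (hh k) (le_max_right _ _) hC hL
      (fun z hz => (hM z hz).trans (le_max_left _ _)) (fun u _ => hΓ u) (fun u hu => ?_)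
      (fun i hi => ⟨hnh k i hi.le, ?_⟩) (hstep k)
    · have hu' : u ∈ Icc 0 (1 + T) :=
        ⟨(ht k).1.trans hu.1, hu.2.trans (hnh k (n k) le_rfl).2⟩
      exact ⟨hu', mem_closedBall_zero_iff.2 ((hB u hu').trans (le_max_right _ _))⟩
    · exact mem_closedBall_zero_iff.2 ((hZ k i hi).trans (le_max_left _ _))
  have hz : Filter.Tendsto (fun k => ‖Z k 0 - Γ (t k)‖) Filter.atTop (𝓝 0) := by
    have := (hlim_Z.sub ((hcont.tendsto t').comp hlim_t)).norm
    simpa using this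
  have hbound : Filter.Tendsto (fun k => (‖Z k 0 - Γ (t k)‖ +
      (n k * h k) * ((C + L * (1 + max M 0)) * h k)) * exp (L * (n k * h k))) Filter.atTop
      (𝓝 0) := by
    have := (hz.add (hlim_n.mul (hlim_h.const_mul (C + L * (1 + max M 0))))).mul
      ((continuous_exp.tendsto _).comp (hlim_n.const_mul (L : ℝ)))
    simpa using this
  have h1 := squeeze_zero_norm key hbound
  have h2 := h1.add ((hcont.tendsto _).comp (hlim_t.add hlim_n))
  simpa using h2

variable (E) in
/-- The floor of the tetragon with parameter `R`, in an arbitrary Euclidean space. -/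
def radialFloor (R : ℝ) : Set (E × E) :=
  (fun z : E × ℝ => ((√R * cos z.2) • z.1, (√R * sin z.2) • z.1)) ''
    (Metric.sphere 0 1 ×ˢ Icc 0 (π / 2))

lemma isClosed_radialFloor [FiniteDimensional ℝ E] (R : ℝ) : IsClosed (radialFloor E R) := by
  refine (((isCompact_sphere (0 : E) 1).prod isCompact_Icc).image ?_).isClosed
  fun_prop

lemma mem_radialFloor {R : ℝ} (hR : 0 < R) {x : E} (hx : x ≠ 0) (hxR : ‖x‖ ≤ √R) :
    ((√(R - ‖x‖ ^ 2) / ‖x‖) • x, x) ∈ radialFloor E R := by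
  have hs : 0 < √R := sqrt_pos.2 hR
  have hn : ‖x‖ ≠ 0 := norm_ne_zero_iff.2 hx
  have h1 : ‖x‖ / √R ≤ 1 := (div_le_one hs).2 hxR
  have h0 : 0 ≤ ‖x‖ / √R := by positivity
  refine ⟨(‖x‖⁻¹ • x, arcsin (‖x‖ / √R)), ⟨?_, arcsin_nonneg.2 h0, arcsin_le_pi_div_two _⟩, ?_⟩
  · rw [mem_sphere_zero_iff_norm, norm_smul, norm_inv, norm_norm, inv_mul_cancel₀ hn]
  · have h2 : √R * √(1 - (‖x‖ / √R) ^ 2) = √(R - ‖x‖ ^ 2) := by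
      rw [← sqrt_mul hR.le, div_pow, sq_sqrt hR.le]
      congr 1
      field_simp
    simp only [cos_arcsin, sin_arcsin (by linarith) h1, h2, smul_smul, ← div_eq_mul_inv,
      mul_div_cancel₀ _ hs.ne', div_self hn, one_smul]

lemma mem_radialFloor_zero {R : ℝ} (hR : 0 < R) {p : E} (hp : ‖p‖ = √R) :
    (p, (0 : E)) ∈ radialFloor E R := by
  have hs : √R ≠ 0 := (sqrt_pos.2 hR).ne'
  refine ⟨((√R)⁻¹ • p, 0), ⟨?_, le_rfl, by positivity⟩, ?_⟩
  · rw [mem_sphere_zero_iff_norm, norm_smul, hp, norm_inv, norm_of_nonneg (sqrt_nonneg _),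
      inv_mul_cancel₀ hs]
  · simp [smul_smul, hs]

lemma norm_sq_of_mem_radialFloor {R : ℝ} (hR : 0 < R) {z : E × E} (hz : z ∈ radialFloor E R) :
    ‖z.1‖ ^ 2 + ‖z.2‖ ^ 2 = R := by
  obtain ⟨⟨u, θ⟩, ⟨hu, -⟩, rfl⟩ := hz
  rw [mem_sphere_zero_iff_norm] at hu
  simp only [norm_smul, hu, mul_one, norm_eq_abs, sq_abs, mul_pow, sq_sqrt hR.le]
  linear_combination R * cos_sq_add_sin_sq θ

namespace ShellPotential

variable {R₀ R₁ β : ℝ} (S : ShellPotential E R₀ R₁ β)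

/-- The Hamiltonian vector field, extended by the rate of change of the energy. -/
def field (z : ℝ × E × E × ℝ) : E × E × ℝ :=
  (-S.g (z.2.2.1, z.1), z.2.1, S.vt (z.2.2.1, z.1))

lemma contDiff_field : ContDiff ℝ 1 S.field := by
  have := S.contDiff_g
  have := S.contDiff_vt
  unfold field
  fun_prop

lemma hasDerivAt_energy {Γ : ℝ → E × E}
    (hΓ : ∀ s, HasDerivAt Γ (-S.g ((Γ s).2, s), (Γ s).1) s) (s : ℝ) :
    HasDerivAt (fun s => ‖(Γ s).1‖ ^ 2 / 2 + S.V ((Γ s).2, s)) (S.vt ((Γ s).2, s)) s := by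
  have h0 : HasDerivAt (fun s => (Γ s).1) (-S.g ((Γ s).2, s)) s :=
    (hasFDerivAt_fst (𝕜 := ℝ) (p := Γ s)).comp_hasDerivAt s (hΓ s)
  have h0' : HasDerivAt (fun s => (Γ s).2) (Γ s).1 s :=
    (hasFDerivAt_snd (𝕜 := ℝ) (p := Γ s)).comp_hasDerivAt s (hΓ s)
  have h1 := h0.norm_sq.div_const 2
  have h2 : HasDerivAt (fun s => S.V ((Γ s).2, s)) _ s :=
    (S.hasFDerivAt ((Γ s).2, s)).comp_hasDerivAt (f := fun s => ((Γ s).2, s)) s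
      (h0'.prodMk (hasDerivAt_id s))
  refine (h1.add h2).congr_deriv ?_
  simp [real_inner_comm]
  ring

variable {S}

namespace IsDiscreteChord

variable {h t : ℝ} {n : ℕ} {P x : ℕ → E}

lemma norm_end_P_le (H : S.IsDiscreteChord h n t P x) : ‖P n‖ ≤ √R₁ := by
  rw [H.end_P, norm_smul, norm_div, norm_norm, div_mul_cancel₀ _ (norm_ne_zero_iff.2 H.end_ne),
    norm_of_nonneg (sqrt_nonneg _)]
  exact sqrt_le_sqrt (by nlinarith [sq_nonneg ‖x n‖])

lemma norm_P_le (H : S.IsDiscreteChord h n t P x) (hh : 0 ≤ h) {M : ℝ}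
    (hM : ∀ i < n, ‖S.g (x i, t + i * h)‖ ≤ M) {i : ℕ} (hi : i ≤ n) :
    ‖P i‖ ≤ √R₁ + (n * h) * M := by
  have key : ∀ j ≤ n, ‖P (n - j)‖ ≤ √R₁ + (j * h) * M := fun j => by
    induction j with
    | zero => intro _; simpa using H.norm_end_P_le
    | succ j ih =>
      intro hj
      have h1 := H.step_P (n - (j + 1)) (by omega)
      rw [show n - (j + 1) + 1 = n - j by omega, eq_sub_iff_add_eq] at h1
      rw [← h1]
      refine (norm_add_le _ _).trans ?_
      rw [norm_smul, norm_of_nonneg hh]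
      have h2 := mul_le_mul_of_nonneg_left (hM (n - (j + 1)) (by omega)) hh
      have h3 := ih (by omega)
      push_cast
      linarith
  have h1 := key (n - i) (Nat.sub_le _ _)
  rw [Nat.sub_sub_self hi] at h1
  have hM0 : 0 ≤ M := (norm_nonneg _).trans (hM 0 H.pos)
  refine h1.trans ?_
  have : ((n - i : ℕ) : ℝ) ≤ n := by exact_mod_cast Nat.sub_le n i
  gcongr

end IsDiscreteChord

/-- The extended discrete trajectory, with the accumulated energy change as last entry. -/
def extend (S : ShellPotential E R₀ R₁ β) (h t : ℝ) (P x : ℕ → E) (i : ℕ) : E × E × ℝ :=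
  (P i, x i, h * ∑ j ∈ Finset.range i, S.vt (x j, t + j * h))

namespace IsDiscreteChord

variable {h t : ℝ} {n : ℕ} {P x : ℕ → E}

lemma norm_extend_le (H : S.IsDiscreteChord h n t P x) (hh : 0 ≤ h) {M : ℝ}
    (hM : ∀ i < n, ‖S.g (x i, t + i * h)‖ ≤ M) (hM' : ∀ i < n, ‖S.vt (x i, t + i * h)‖ ≤ M)
    {i : ℕ} (hi : i ≤ n) : ‖extend S h t P x i‖ ≤ √R₁ + (n * h) * M := by
  have hM0 : 0 ≤ M := (norm_nonneg _).trans (hM 0 H.pos)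
  have h0 : 0 ≤ n * h * M := by positivity
  refine max_le (H.norm_P_le hh hM hi) (max_le ?_ ?_)
  · have h1 : ‖(extend S h t P x i).2.1‖ ≤ √R₁ := H.mem i
    linarith
  · have h1 : ‖∑ j ∈ Finset.range i, S.vt (x j, t + j * h)‖ ≤ i * M := by
      refine (norm_sum_le_of_le (Finset.range i) (f := fun j => S.vt (x j, t + j * h))
        (n := fun _ => M) fun j hj => hM' j ((Finset.mem_range.1 hj).trans_le hi)).trans_eq ?_
      simp
    have h2 : (i : ℝ) ≤ n := by exact_mod_cast hi
    simp only [extend]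
    rw [norm_mul, norm_of_nonneg hh]
    have h3 : h * ‖∑ j ∈ Finset.range i, S.vt (x j, t + j * h)‖ ≤ h * (n * M) := by
      refine mul_le_mul_of_nonneg_left (h1.trans ?_) hh
      gcongr
    linarith [sqrt_nonneg R₁]

lemma norm_extend_step_le (H : S.IsDiscreteChord h n t P x) (hh : 0 ≤ h) {M : ℝ}
    (hM : ∀ i < n, ‖S.g (x i, t + i * h)‖ ≤ M) {i : ℕ} (hi : i < n) :
    ‖extend S h t P x (i + 1) - extend S h t P x i -
      h • S.field (t + i * h, extend S h t P x i)‖ ≤ M * h * h := by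
  have h1 : extend S h t P x (i + 1) - extend S h t P x i -
      h • S.field (t + i * h, extend S h t P x i) =
      (0, -(h • h • S.g (x i, t + i * h)), 0) := by
    simp only [extend, field, H.step_x i hi, H.step_P i hi, Finset.sum_range_succ,
      Prod.smul_mk, Prod.mk_sub_mk, Prod.mk.injEq, smul_eq_mul, smul_sub, smul_neg]
    refine ⟨by abel, by abel, by ring⟩
  have hM0 : 0 ≤ M := (norm_nonneg _).trans (hM i hi)
  rw [h1, Prod.norm_mk, Prod.norm_mk, norm_neg, norm_zero, norm_zero, norm_smul, norm_smul,
    norm_of_nonneg hh]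
  refine max_le (by positivity) (max_le ?_ (by positivity))
  have := mul_le_mul_of_nonneg_left (mul_le_mul_of_nonneg_left (hM i hi) hh) hh
  linarith

end IsDiscreteChord

end ShellPotential

namespace ShellPotential

variable {R₀ R₁ β : ℝ} {S : ShellPotential E R₀ R₁ β}

lemma exists_isDiscreteChord_eventually [FiniteDimensional ℝ E] [Nontrivial E]
    (S : ShellPotential E R₀ R₁ β) {T : ℝ} (hT : 0 < T)
    (hTA : T * (R₀ / 2 + β) = π * (R₁ - R₀) / 4) :
    ∀ᶠ N : ℕ in Filter.atTop, ∃ (n : ℕ) (t : ℝ) (P x : ℕ → E), n * (T / N) ≤ T ∧ t ∈ Icc (0 : ℝ) 1 ∧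
      S.IsDiscreteChord (T / N) n t P x := by
  have h1 := tendsto_const_div_atTop_nhds_zero_nat T
  have hR : 0 < (R₁ - R₀) / 2 := half_pos (sub_pos.2 S.hR)
  filter_upwards [h1.eventually_lt_const one_pos,
    (h1.mul_const R₁).eventually_lt_const (by rwa [zero_mul]), Filter.eventually_ge_atTop 1]
    with N h2 h3 h4
  have hN : (0 : ℝ) < N := by exact_mod_cast h4
  obtain ⟨n, t, P, x, hn, ht, H⟩ := exists_isDiscreteChord S (div_pos hT hN) h2.le h3 h4
    (by rw [mul_div_cancel₀ _ hN.ne', hTA])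
  refine ⟨n, t, P, x, ?_, ht, H⟩
  have : (n : ℝ) ≤ N := by exact_mod_cast hn
  calc n * (T / N) ≤ N * (T / N) := by gcongr
    _ = T := mul_div_cancel₀ _ (ne_of_gt hN)

/-- Limits of discrete chords start on the floor. -/
lemma mem_radialFloor_of_start {Eend : ℝ} {p q : E} {t' : ℝ} {h t : ℕ → ℝ} {n : ℕ → ℕ}
    {P x : ℕ → ℕ → E} [FiniteDimensional ℝ E]
    (H : ∀ k, S.IsDiscreteChord (h k) (n k) (t k) (P k) (x k))
    (hh : Filter.Tendsto h Filter.atTop (𝓝 0))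
    (hp : Filter.Tendsto (fun k => P k 0) Filter.atTop (𝓝 p))
    (hq : Filter.Tendsto (fun k => x k 0) Filter.atTop (𝓝 q))
    (hlow : Filter.Tendsto (fun k => ‖P k (n k)‖ ^ 2 / 2 +
      S.V (x k (n k) - h k • P k (n k), t k + n k * h k - h k)) Filter.atTop (𝓝 Eend))
    (hup : Filter.Tendsto (fun k => ‖P k (n k)‖ ^ 2 / 2 +
      S.V (x k (n k), t k + n k * h k)) Filter.atTop (𝓝 Eend))
    (hE : Eend = ‖p‖ ^ 2 / 2 + S.V (q, t')) : (p, q) ∈ radialFloor E R₀ := by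
  have hε : Filter.Tendsto (fun k => R₁ * √(3 * h k)) Filter.atTop (𝓝 0) := by
    have h1 : Continuous fun s : ℝ => R₁ * √(3 * s) := by fun_prop
    have h2 := (h1.tendsto 0).comp hh
    rwa [mul_zero, sqrt_zero, mul_zero] at h2
  have hfr : ∃ᶠ k in Filter.atTop, (P k 0, x k 0) ∈ radialFloor E R₀ ∨
      (x k 0, (‖P k (n k)‖ ^ 2 / 2 + S.V (x k (n k) - h k • P k (n k), t k + n k * h k - h k)) +
        R₁ * √(3 * h k), ‖P k 0‖,
        (‖P k (n k)‖ ^ 2 / 2 + S.V (x k (n k), t k + n k * h k)) - R₁ * √(3 * h k)) ∈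
      {z : E × ℝ × ℝ × ℝ | z.1 = 0 ∧ R₀ / 2 ≤ z.2.1 ∧ (z.2.2.1 ≤ √R₀ ∨ z.2.2.2 ≤ R₀ / 2)} := by
    refine (Filter.Eventually.of_forall fun k => ?_).frequently
    rcases (H k).start with ⟨h1, h2, h3⟩ | ⟨h1, h2, h3⟩
    · left
      rw [h3]
      exact mem_radialFloor S.hR₀ h1 h2
    · right
      refine ⟨h1, ?_, h3.imp id fun h4 => ?_⟩
      · dsimp only
        linarith
      · dsimp only
        linarith
  rcases Filter.frequently_or_distrib.1 hfr with h1 | h1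
  · exact (isClosed_radialFloor R₀).mem_of_frequently_of_tendsto h1 (hp.prodMk_nhds hq)
  · have hcl : IsClosed {z : E × ℝ × ℝ × ℝ |
        z.1 = 0 ∧ R₀ / 2 ≤ z.2.1 ∧ (z.2.2.1 ≤ √R₀ ∨ z.2.2.2 ≤ R₀ / 2)} := by
      have c1 : IsClosed {z : E × ℝ × ℝ × ℝ | z.1 = 0} := isClosed_eq (by fun_prop) (by fun_prop)
      have c2 : IsClosed {z : E × ℝ × ℝ × ℝ | R₀ / 2 ≤ z.2.1} :=
        isClosed_le (by fun_prop) (by fun_prop)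
      have c3 : IsClosed {z : E × ℝ × ℝ × ℝ | z.2.2.1 ≤ √R₀} :=
        isClosed_le (by fun_prop) (by fun_prop)
      have c4 : IsClosed {z : E × ℝ × ℝ × ℝ | z.2.2.2 ≤ R₀ / 2} :=
        isClosed_le (by fun_prop) (by fun_prop)
      exact c1.inter (c2.inter (c3.union c4))
    obtain ⟨h2, h3, h4⟩ := hcl.mem_of_frequently_of_tendsto h1
      (hq.prodMk_nhds ((hlow.add hε).prodMk_nhds (hp.norm.prodMk_nhds (hup.sub hε))))
    simp only [add_zero, sub_zero] at h2 h3 h4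
    subst h2
    rw [S.at_zero, add_zero] at hE
    have h5 : √R₀ ≤ ‖p‖ := sqrt_le_iff.2 ⟨norm_nonneg _, by linarith⟩
    refine mem_radialFloor_zero S.hR₀ (le_antisymm ?_ h5)
    rcases h4 with h4 | h4
    · exact h4
    · exact le_sqrt_of_sq_le (by linarith)

/-- Existence of a chord from floor to ceiling of time-length at most
`π (R₁ - R₀) / (2 R₀ + 4 β)`. -/
theorem exists_chord [FiniteDimensional ℝ E] [Nontrivial E] (S : ShellPotential E R₀ R₁ β)
    (hcomplete : ∀ (t₀ : ℝ) (z : E × E), ∃ Γ : ℝ → E × E, Γ t₀ = z ∧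
      ∀ s, HasDerivAt Γ (-S.g ((Γ s).2, s), (Γ s).1) s) :
    ∃ (t τ : ℝ) (Γ : ℝ → E × E), 0 < τ ∧ τ ≤ π * (R₁ - R₀) / (2 * R₀ + 4 * β) ∧
      (∀ s, HasDerivAt Γ (-S.g ((Γ s).2, s), (Γ s).1) s) ∧
      Γ t ∈ radialFloor E R₀ ∧ Γ (t + τ) ∈ radialFloor E R₁ := by
  have hR₀ := S.hR₀
  have hden : 0 < 2 * R₀ + 4 * β := by linarith [S.hβ]
  set T := π * (R₁ - R₀) / (2 * R₀ + 4 * β) with hTdef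
  have hT : 0 < T := div_pos (mul_pos pi_pos (sub_pos.2 S.hR)) hden
  have hTA : T * (R₀ / 2 + β) = π * (R₁ - R₀) / 4 := by
    rw [hTdef, div_mul_eq_mul_div, div_eq_iff hden.ne']
    ring
  obtain ⟨N₀, hN₀⟩ := Filter.eventually_atTop.1 (exists_isDiscreteChord_eventually S hT hTA)
  choose n t P x hnT ht H using fun k : ℕ => hN₀ (N₀ + k) (Nat.le_add_right _ _)
  set h : ℕ → ℝ := fun k => T / (N₀ + k : ℕ) with hhdef
  have hh : ∀ k, 0 ≤ h k := fun k => by positivity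
  have hlim_h : Filter.Tendsto h Filter.atTop (𝓝 0) :=
    (tendsto_const_div_atTop_nhds_zero_nat T).comp
      (Filter.tendsto_atTop_mono (fun k => Nat.le_add_left k N₀) Filter.tendsto_id)
  have hQ : IsCompact (Metric.closedBall (0 : E) (√R₁) ×ˢ Icc (0 : ℝ) (1 + T)) :=
    (isCompact_closedBall _ _).prod isCompact_Icc
  obtain ⟨M₁, hM₁⟩ := hQ.exists_bound_of_continuousOn S.contDiff_g.continuous.continuousOn
  obtain ⟨M₂, hM₂⟩ := hQ.exists_bound_of_continuousOn S.contDiff_vt.continuous.continuousOn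
  set M := max M₁ M₂ with hMdef
  have hmem : ∀ (k i : ℕ), i < n k → (x k i, t k + i * h k) ∈
      Metric.closedBall (0 : E) (√R₁) ×ˢ Icc (0 : ℝ) (1 + T) := fun k i hi => by
    refine ⟨mem_closedBall_zero_iff.2 ((H k).mem i), ?_, ?_⟩
    · exact add_nonneg (ht k).1 (mul_nonneg (Nat.cast_nonneg _) (hh k))
    · have h1 : (i : ℝ) * h k ≤ n k * h k := by
        have := hh k
        gcongr
      exact add_le_add (ht k).2 (h1.trans (hnT k))
  have hMg : ∀ (k i : ℕ), i < n k → ‖S.g (x k i, t k + i * h k)‖ ≤ M := fun k i hi =>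
    (hM₁ _ (hmem k i hi)).trans (le_max_left _ _)
  have hMv : ∀ (k i : ℕ), i < n k → ‖S.vt (x k i, t k + i * h k)‖ ≤ M := fun k i hi =>
    (hM₂ _ (hmem k i hi)).trans (le_max_right _ _)
  have hM0 : 0 ≤ M := (norm_nonneg _).trans (hMg 0 0 (H 0).pos)
  have hbound : ∀ (k i : ℕ), i ≤ n k → ‖extend S (h k) (t k) (P k) (x k) i‖ ≤ √R₁ + T * M :=
    fun k i hi => ((H k).norm_extend_le (hh k) (hMg k) (hMv k) hi).trans (by
      have := hnT k
      gcongr)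
  obtain ⟨⟨z₀, t', τ⟩, ⟨-, ht', hτ⟩, φ, hφ, hlim⟩ :=
    ((isCompact_closedBall (0 : E × E × ℝ) (√R₁ + T * M)).prod
      ((isCompact_Icc (a := (0 : ℝ)) (b := 1)).prod (isCompact_Icc (a := (0 : ℝ)) (b := T)))
      ).tendsto_subseq (x := fun k => (extend S (h k) (t k) (P k) (x k) 0, t k, n k * h k))
      fun k => ⟨mem_closedBall_zero_iff.2 (hbound k 0 (Nat.zero_le _)), ht k,
        mul_nonneg (Nat.cast_nonneg _) (hh k), hnT k⟩
  have hlim_Z := hlim.fst_nhds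
  have hlim_t := hlim.snd_nhds.fst_nhds
  have hlim_n := hlim.snd_nhds.snd_nhds
  have hlim_hφ := hlim_h.comp hφ.tendsto_atTop
  simp only [Function.comp_def] at hlim_Z hlim_t hlim_n hlim_hφ
  have hz₀ : z₀.2.2 = 0 := by
    refine tendsto_nhds_unique hlim_Z.snd_nhds.snd_nhds ?_
    simp [extend]
  obtain ⟨Γ, hΓ0, hΓ⟩ := hcomplete t' (z₀.1, z₀.2.1)
  set W : ℝ → ℝ := fun s => ‖(Γ s).1‖ ^ 2 / 2 + S.V ((Γ s).2, s) with hW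
  have hΓ' : ∀ s, HasDerivAt (fun s => ((Γ s).1, (Γ s).2, W s - W t'))
      (S.field (s, (Γ s).1, (Γ s).2, W s - W t')) s := fun s =>
    ((hasFDerivAt_fst (𝕜 := ℝ) (p := Γ s)).comp_hasDerivAt s (hΓ s)).prodMk
      (((hasFDerivAt_snd (𝕜 := ℝ) (p := Γ s)).comp_hasDerivAt s (hΓ s)).prodMk
        ((S.hasDerivAt_energy hΓ s).sub_const _))
  have hend := tendsto_euler S.contDiff_field hΓ' (t := fun k => t (φ k)) (h := fun k => h (φ k))
    (n := fun k => n (φ k)) (Z := fun k => extend S (h (φ k)) (t (φ k)) (P (φ k)) (x (φ k)))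
    (T := T) (C := M) (ρ := √R₁ + T * M) (t' := t') (τ := τ) hM0 (fun k => hh _) (fun k => ht _)
    (fun k => hnT _) (fun k i hi => hbound _ i hi.le)
    (fun k i hi => (H (φ k)).norm_extend_step_le (hh _) (hMg _) hi) hlim_hφ hlim_t hlim_n (by
      rw [hΓ0, sub_self, ← hz₀]
      exact hlim_Z)
  have hP := hend.fst_nhds
  have hx := hend.snd_nhds.fst_nhds
  have hw := hend.snd_nhds.snd_nhds
  simp only [extend] at hP hx hw
  have hsum : ∀ k, h k * ∑ j ∈ Finset.range (n k), S.vt (x k j, t k + j * h k) = 0 := fun k => by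
    rw [(H k).sum_vt, mul_zero]
  simp only [hsum] at hw
  have hWend : W (t' + τ) = W t' := by
    have := tendsto_nhds_unique hw tendsto_const_nhds
    linarith
  have hV := S.continuous_V
  have hup : Filter.Tendsto (fun k => ‖P (φ k) (n (φ k))‖ ^ 2 / 2 +
      S.V (x (φ k) (n (φ k)), t (φ k) + n (φ k) * h (φ k))) Filter.atTop (𝓝 (W (t' + τ))) :=
    ((hP.norm.pow 2).div_const 2).add
      ((hV.tendsto _).comp (hx.prodMk_nhds (hlim_t.add hlim_n)))
  have hlow : Filter.Tendsto (fun k => ‖P (φ k) (n (φ k))‖ ^ 2 / 2 +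
      S.V (x (φ k) (n (φ k)) - h (φ k) • P (φ k) (n (φ k)),
        t (φ k) + n (φ k) * h (φ k) - h (φ k))) Filter.atTop (𝓝 (W (t' + τ))) := by
    have h1 := ((hx.sub (hlim_hφ.smul hP)).prodMk_nhds ((hlim_t.add hlim_n).sub hlim_hφ))
    rw [zero_smul, sub_zero, sub_zero] at h1
    exact ((hP.norm.pow 2).div_const 2).add ((hV.tendsto _).comp h1)
  have hfloor : Γ t' ∈ radialFloor E R₀ := by
    rw [hΓ0]
    refine mem_radialFloor_of_start (S := S) (t' := t') (fun k => H (φ k)) hlim_hφ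
      hlim_Z.fst_nhds hlim_Z.snd_nhds.fst_nhds hlow hup ?_
    rw [hWend]
    simp only [hW, hΓ0]
  have hceil : Γ (t' + τ) ∈ radialFloor E R₁ :=
    (isClosed_radialFloor R₁).mem_of_tendsto (hP.prodMk_nhds hx)
      (Filter.Eventually.of_forall fun k => by
        have h1 := mem_radialFloor S.hR₁ (H (φ k)).end_ne ((H (φ k)).mem _)
        rwa [← (H (φ k)).end_P] at h1)
  refine ⟨t', τ, Γ, lt_of_le_of_ne hτ.1 fun h0 => ?_, hτ.2, hΓ, hfloor, hceil⟩
  have h1 := norm_sq_of_mem_radialFloor S.hR₀ hfloor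
  have h2 := norm_sq_of_mem_radialFloor S.hR₁ hceil
  rw [← h0, add_zero] at h2
  linarith [S.hR]

end ShellPotential

lemma eucNorm_ofLp {k : ℕ} (x : EuclideanSpace ℝ (Fin k)) : eucNorm (WithLp.ofLp x) = ‖x‖ := by
  simp [eucNorm, EuclideanSpace.norm_eq]

/-- Pairs of Euclidean vectors read as points of phase space. -/
def toPhase (k : ℕ) : (EuclideanSpace ℝ (Fin k) × EuclideanSpace ℝ (Fin k)) ≃L[ℝ] Phase k :=
  (EuclideanSpace.equiv (Fin k) ℝ).prodCongr (EuclideanSpace.equiv (Fin k) ℝ)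

lemma toPhase_mem_sphereFloor {k : ℕ} {R : ℝ}
    {z : EuclideanSpace ℝ (Fin k) × EuclideanSpace ℝ (Fin k)}
    (hz : z ∈ radialFloor (EuclideanSpace ℝ (Fin k)) R) : toPhase k z ∈ sphereFloor k R := by
  obtain ⟨⟨u, θ⟩, ⟨hu, hθ⟩, rfl⟩ := hz
  exact ⟨WithLp.ofLp u, θ, (eucNorm_ofLp u).trans (mem_sphere_zero_iff_norm.1 hu), hθ, rfl⟩

/-- The potential `U` as a function on Euclidean space, with its derivatives. -/
def shellPotential {k : ℕ} {R₀ R₁ β : ℝ} (hR₀ : 0 < R₀) (hR : R₀ < R₁) (hβ : 0 ≤ β)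
    {U : Vec k × ℝ → ℝ} (hU : ContDiff ℝ (⊤ : ℕ∞) U) (hper : ∀ q t, U (q, t + 1) = U (q, t))
    (hshell : ∀ q t, √R₀ ≤ eucNorm q → eucNorm q ≤ √R₁ → U (q, t) ≤ -β)
    (hU0 : ∀ t, U (0, t) = 0) : ShellPotential (EuclideanSpace ℝ (Fin k)) R₀ R₁ β where
  V z := U (WithLp.ofLp z.1, z.2)
  g z := WithLp.toLp 2 fun i => fderiv ℝ U (WithLp.ofLp z.1, z.2) (Pi.single i 1, 0)
  vt z := fderiv ℝ U (WithLp.ofLp z.1, z.2) (0, 1)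
  hR₀ := hR₀
  hR := hR
  hβ := hβ
  hasFDerivAt z := by
    have hd : HasFDerivAt U (fderiv ℝ U (WithLp.ofLp z.1, z.2)) (WithLp.ofLp z.1, z.2) :=
      (hU.differentiable (by simp) _).hasFDerivAt
    have hL := (((EuclideanSpace.equiv (Fin k) ℝ).toContinuousLinearMap.prodMap
      (ContinuousLinearMap.id ℝ ℝ)).hasFDerivAt (x := z))
    refine (hd.comp z hL).congr_fderiv (ContinuousLinearMap.ext fun v => ?_)
    have hv : (WithLp.ofLp v.1, v.2) =
        (∑ i, v.1 i • ((Pi.single i 1, 0) : Vec k × ℝ)) + v.2 • ((0, 1) : Vec k × ℝ) := by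
      ext i
      · simp [Prod.fst_sum, Finset.sum_apply, Pi.single_apply]
      · simp [Prod.snd_sum]
    change fderiv ℝ U (WithLp.ofLp z.1, z.2) (WithLp.ofLp v.1, v.2) = _
    rw [hv, map_add, map_sum]
    simp only [map_smul]
    simp [PiLp.inner_apply, mul_comm (v.2)]
  contDiff_g := by
    have hd : ContDiff ℝ 1 (fderiv ℝ U) := hU.fderiv_right (by norm_cast)
    have he : ContDiff ℝ 1 fun z : EuclideanSpace ℝ (Fin k) × ℝ => (WithLp.ofLp z.1, z.2) := by
      fun_prop
    rw [contDiff_euclidean]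
    exact fun i => (hd.comp he).clm_apply contDiff_const
  contDiff_vt := by
    have hd : ContDiff ℝ 1 (fderiv ℝ U) := hU.fderiv_right (by norm_cast)
    have he : ContDiff ℝ 1 fun z : EuclideanSpace ℝ (Fin k) × ℝ => (WithLp.ofLp z.1, z.2) := by
      fun_prop
    exact (hd.comp he).clm_apply contDiff_const
  periodic q t := hper _ t
  le_neg q t h₀ h₁ := hshell _ t ((eucNorm_ofLp q).symm ▸ h₀) ((eucNorm_ofLp q).symm ▸ h₁)
  at_zero t := hU0 t

lemma gradVec_add_const {k : ℕ} (f : Vec k → ℝ) (c : ℝ) (x : Vec k) :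
    gradVec (fun y => f y + c) x = gradVec f x := by
  funext i
  rw [gradVec, gradVec, fderiv_add_const]

lemma gradVec_const_add {k : ℕ} (f : Vec k → ℝ) (c : ℝ) (x : Vec k) :
    gradVec (fun y => c + f y) x = gradVec f x := by
  funext i
  rw [gradVec, gradVec, fderiv_const_add]

lemma gradVec_kinetic {k : ℕ} (p : Vec k) : gradVec (fun y => (∑ i, y i ^ 2) / 2) p = p := by
  have h : HasFDerivAt (fun y : Vec k => (∑ i, y i ^ 2) / 2)
      ((2 : ℝ)⁻¹ • ∑ i, (2 * p i) • ContinuousLinearMap.proj (R := ℝ) (φ := fun _ : Fin k => ℝ) i)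
      p := by
    simp only [div_eq_inv_mul]
    refine (HasFDerivAt.fun_sum fun i _ => ?_).const_mul _
    simpa using (hasFDerivAt_apply (𝕜 := ℝ) i p).pow 2
  funext j
  rw [gradVec, h.fderiv]
  simp [Pi.single_apply]

lemma gradVec_slice {k : ℕ} {U : Vec k × ℝ → ℝ} (hU : Differentiable ℝ U) (q : Vec k) (t : ℝ) :
    gradVec (fun y => U (y, t)) q = fun i => fderiv ℝ U (q, t) (Pi.single i 1, 0) := by
  have h := (hU (q, t)).hasFDerivAt.comp q (hasFDerivAt_prodMk_left (𝕜 := ℝ) q t)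
  funext i
  rw [gradVec, show (fun y => U (y, t)) = U ∘ fun y => (y, t) from rfl, h.fderiv]
  simp

/-- Solutions of Hamilton's equations of a mechanical Hamiltonian in phase space
correspond to those in Euclidean space. -/
lemma isHamSolOn_iff {k : ℕ} {U : Vec k × ℝ → ℝ} (hU : Differentiable ℝ U) (γ : ℝ → Phase k)
    (I : Set ℝ) :
    IsHamSolOn (fun z => (∑ i, z.1.1 i ^ 2) / 2 + U (z.1.2, z.2)) γ I ↔
      ∀ t ∈ I, HasDerivAt γ
        (-(fun i => fderiv ℝ U ((γ t).2, t) (Pi.single i 1, 0)), (γ t).1) t := by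
  simp only [IsHamSolOn, gradVec_add_const, gradVec_const_add, gradVec_kinetic, gradVec_slice hU]
  refine forall₂_congr fun t _ => ⟨fun h => h.1.prodMk h.2, fun h => ?_⟩
  exact ⟨(hasFDerivAt_fst (𝕜 := ℝ) (p := γ t)).comp_hasDerivAt t h,
    (hasFDerivAt_snd (𝕜 := ℝ) (p := γ t)).comp_hasDerivAt t h⟩

end

/-- Corollary 1.9: for a mechanical Hamiltonian `G = |p|²/2 + U(q,t)`
with `U ≤ -β` on the spherical shell `√R₀ ≤ |q| ≤ √R₁` and `U(0,t) = 0`, there is a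
Hamiltonian chord of `G` from the floor to the ceiling of the tetragon of time-length at
most `π(R₁-R₀)/(2R₀+4β)`. -/
theorem stmt_5 (k : ℕ) (hk : 1 ≤ k) (R₀ R₁ : ℝ) (hR₀ : 0 < R₀) (hR : R₀ < R₁)
    (U : Vec k × ℝ → ℝ) (hU : ContDiff ℝ (⊤ : ℕ∞) U)
    (hperU : ∀ q t, U (q, t + 1) = U (q, t))
    (β : ℝ) (hβ : 0 ≤ β)
    (hUshell : ∀ q t, Real.sqrt R₀ ≤ eucNorm q → eucNorm q ≤ Real.sqrt R₁ →
      U (q, t) ≤ -β)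
    (hU0 : ∀ t, U (0, t) = 0)
    (G : Phase k × ℝ → ℝ) (hG : G = fun z => (∑ i, z.1.1 i ^ 2) / 2 + U (z.1.2, z.2))
    (hcomp : HamComplete G) :
    ∃ (t₀ τ : ℝ) (γ : ℝ → Phase k), 0 < τ ∧ τ ≤ π * (R₁ - R₀) / (2 * R₀ + 4 * β) ∧
      IsHamSolOn G γ (Icc t₀ (t₀ + τ)) ∧
      γ t₀ ∈ sphereFloor k R₀ ∧ γ (t₀ + τ) ∈ sphereFloor k R₁ := by
  subst hG
  have hd : Differentiable ℝ U := hU.differentiable (by simp)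
  have : Nonempty (Fin k) := ⟨⟨0, hk⟩⟩
  obtain ⟨t, τ, Γ, hτ, hle, hΓ, h₀, h₁⟩ :=
    (shellPotential hR₀ hR hβ hU hperU hUshell hU0).exists_chord fun t₀ z => by
      obtain ⟨γ, hγ0, hγ⟩ := hcomp t₀ (toPhase k z)
      refine ⟨fun s => (toPhase k).symm (γ s), by simp [hγ0],
        fun s => ?_⟩
      exact (toPhase k).symm.hasFDerivAt.comp_hasDerivAt s
        ((isHamSolOn_iff hd γ univ).1 hγ s (mem_univ s))
  refine ⟨t, τ, fun s => toPhase k (Γ s), hτ, hle, (isHamSolOn_iff hd _ _).2 fun s _ => ?_,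
    toPhase_mem_sphereFloor h₀, toPhase_mem_sphereFloor h₁⟩
  exact (toPhase k).hasFDerivAt.comp_hasDerivAt s (hΓ s)
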